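/- arXiv:1101.4305 — 2 statements merged into one kernel-verified Lean document; each statement's English description precedes it below -/
import Mathlib

section
/- If x and y are elements of the first Weyl algebra A₁ over a field K of characteristic zero such that [y,x] = 1, then the centralizer of yx in A₁ is the polynomial subalgebra generated by yx, i.e. C(yx) = K[yx]. -/
def weylRel (K : Type*) [CommRing K] :
    FreeAlgebra K (Fin 2) → FreeAlgebra K (Fin 2) → Prop :=
  fun a b => a = FreeAlgebra.ι K 1 * FreeAlgebra.ι K 0 ∧
    b = FreeAlgebra.ι K 0 * FreeAlgebra.ι K 1 + 1

/-- The first Weyl algebra `A₁ = K⟨X, Y | YX - XY = 1⟩` over `K`,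
realized as the quotient of the free algebra on two generators `X, Y`
by the relation `Y * X = X * Y + 1`. -/
abbrev WeylAlgebra (K : Type*) [CommRing K] := RingQuot (weylRel K)


structure OrdFilt (K A : Type*) [Field K] [Ring A] [Algebra K A] where
  F : ℤ → Submodule K A
  mono : ∀ {i j a}, a ∈ F i → i ≤ j → a ∈ F j
  neg : ∀ {i a}, a ∈ F i → i < 0 → a = 0
  exh : ∀ a, ∃ i, a ∈ F i
  one_mem : (1 : A) ∈ F 0
  one_ne : (1 : A) ≠ 0
  mul : ∀ {i j a b}, a ∈ F i → b ∈ F j → a * b ∈ F (i + j)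
  comm : ∀ {i j a b}, a ∈ F i → b ∈ F j → a * b - b * a ∈ F (i + j - 1)
  exmul : ∀ {i j a b}, a ∈ F i → a ∉ F (i - 1) → b ∈ F j → b ∉ F (j - 1) →
    a * b ∉ F (i + j - 1)
  onedim : ∀ {h n}, 0 < n → h ∈ F n → h ∉ F (n - 1) → ∀ m c d, h * c = c * h → h * d = d * h →
    c ∈ F m → d ∈ F m → d ∉ F (m - 1) → ∃ l : K, c - l • d ∈ F (m - 1)

set_option linter.unusedSectionVars false

namespace OrdFilt
variable {K A : Type*} [Field K] [CharZero K] [Ring A] [Algebra K A] (O : OrdFilt K A)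

def Ex (O : OrdFilt K A) (i : ℤ) (a : A) : Prop := a ∈ O.F i ∧ a ∉ O.F (i - 1)

theorem Ex.mul {O : OrdFilt K A} {i j : ℤ} {a b : A} (ha : O.Ex i a) (hb : O.Ex j b) :
    O.Ex (i + j) (a * b) :=
  ⟨O.mul ha.1 hb.1, O.exmul ha.1 ha.2 hb.1 hb.2⟩

theorem Ex.one (O : OrdFilt K A) : O.Ex 0 (1 : A) :=
  ⟨O.one_mem, fun h => O.one_ne (O.neg h (by norm_num))⟩

theorem Ex.pow {O : OrdFilt K A} {i : ℤ} {a : A} (ha : O.Ex i a) (k : ℕ) :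
    O.Ex (k * i) (a ^ k) := by
  induction k with
  | zero => simpa using Ex.one O
  | succ k ih =>
    have := ih.mul ha
    rw [pow_succ]; convert this using 1; push_cast; ring

theorem Ex.nonneg {O : OrdFilt K A} {i : ℤ} {a : A} (ha : O.Ex i a) : 0 ≤ i := by
  by_contra h
  have := O.neg ha.1 (by omega)
  exact ha.2 (this ▸ zero_mem _)

theorem Ex.ne {O : OrdFilt K A} {i : ℤ} {a : A} (ha : O.Ex i a) : a ≠ 0 := by
  rintro rfl
  exact ha.2 (zero_mem _)

theorem exists_ex {a : A} (ha : a ≠ 0) : ∃ i, O.Ex i a := by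
  obtain ⟨i, hi⟩ := O.exh a
  have key : ∀ k : ℕ, ∀ i : ℤ, i < k → a ∈ O.F i → ∃ i, O.Ex i a := by
    intro k
    induction k with
    | zero => intro i hi h; exact absurd (O.neg h (by simpa using hi)) ha
    | succ k ih =>
      intro i hi h
      by_cases h' : a ∈ O.F (i - 1)
      · exact ih (i - 1) (by push_cast at hi; omega) h'
      · exact ⟨i, h, h'⟩
  exact key (i.toNat + 1) i (by push_cast; omega) hi

theorem Ex.unique {O : OrdFilt K A} {i j : ℤ} {a : A} (ha : O.Ex i a) (hb : O.Ex j a) : i = j := by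
  by_contra h
  rcases lt_or_gt_of_ne h with h | h
  · exact hb.2 (O.mono ha.1 (by omega))
  · exact ha.2 (O.mono hb.1 (by omega))

theorem Ex.smul {O : OrdFilt K A} {i : ℤ} {a : A} (ha : O.Ex i a) {l : K} (hl : l ≠ 0) :
    O.Ex i (l • a) :=
  ⟨Submodule.smul_mem _ _ ha.1, fun h => ha.2 ((Submodule.smul_mem_iff _ hl).1 h)⟩

theorem Ex.congr {O : OrdFilt K A} {i : ℤ} {a b : A} (ha : O.Ex i a) (h : b - a ∈ O.F (i - 1)) :
    O.Ex i b := by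
  constructor
  · have := add_mem (O.mono h (by omega)) ha.1
    simpa using this
  · intro hb
    have := sub_mem hb h
    exact ha.2 (by simpa using this)

theorem ex_of_mul {n k : ℤ} {g a : A} (hg : O.Ex n g) (h : g * a ∈ O.F (n + k)) : a ∈ O.F k := by
  by_cases ha : a = 0
  · rw [ha]; exact zero_mem _
  obtain ⟨i, hi⟩ := O.exists_ex ha
  by_contra h'
  have : k < i := by
    by_contra h2
    exact h' (O.mono hi.1 (by omega))
  exact (hg.mul hi).2 (O.mono h (by omega))

def E (x y c : A) : A := x * c * y - c * (x * y)

theorem E_sub (x y c d : A) : E x y (c - d) = E x y c - E x y d := by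
  simp only [E]; noncomm_ring

theorem E_smul (x y c : A) (l : K) : E x y (l • c) = l • E x y c := by
  simp only [E, smul_sub, mul_smul_comm, smul_mul_assoc]

section
variable {x y : A} (hxy : y * x - x * y = 1)
include hxy

theorem E_comm {c : A} (hc : y * x * c = c * (y * x)) :
    y * x * E x y c = E x y c * (y * x) := by
  have e : y * x = x * y + 1 := by rw [← hxy]; abel
  have h1 : y * x * (x * c * y) = (x * c * y) * (y * x) := by
    have : y * x * (x * c * y) = x * (y * x * c) * y + x * c * y := by
      rw [e]; nth_rw 2 [show x * y = y * x - 1 by rw [e]; abel]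
      noncomm_ring
    rw [this, hc]
    have : x * (c * (y * x)) * y = x * c * y * (x * y) := by noncomm_ring
    rw [this, e]; noncomm_ring
  have h2 : y * x * (x * y) = (x * y) * (y * x) := by rw [e]; noncomm_ring
  have h3 : y * x * (c * (x * y)) = c * (x * y) * (y * x) := by
    rw [← mul_assoc, hc, mul_assoc, h2]; noncomm_ring
  rw [E, mul_sub, sub_mul, h1, h3]

theorem E_mul {c d : A} (hc : y * x * c = c * (y * x)) (hd : y * x * d = d * (y * x)) :
    x * y * (E x y (c * d) - E x y c * d - c * E x y d) = E x y c * E x y d := by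
  have e : x * y = y * x - 1 := by rw [← hxy]; abel
  have hE := E_comm hxy hc
  have gc : x * y * c = c * (x * y) := by rw [e, sub_mul, mul_sub, hc]; simp
  have gd : x * y * d = d * (x * y) := by rw [e, sub_mul, mul_sub, hd]; simp
  have gE : x * y * E x y c = E x y c * (x * y) := by rw [e, sub_mul, mul_sub, hE]; simp
  have h1 : x * y * (x * (c * d) * y) = x * c * y * (x * d * y) := by
    have : x * y * (x * (c * d) * y) = x * (y * x * c) * d * y := by noncomm_ring
    rw [this, hc]; noncomm_ring
  have h2 : x * y * (E x y c * d) = E x y c * (d * (x * y)) := by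
    rw [← mul_assoc, gE, mul_assoc, gd]
  have h3 : x * y * (c * E x y d) = c * (x * y) * E x y d := by
    rw [← mul_assoc, gc]
  have h4 : x * y * (c * d * (x * y)) = c * (x * y) * (d * (x * y)) := by
    rw [← mul_assoc, ← mul_assoc (x * y) c d, gc]; noncomm_ring
  rw [mul_sub, mul_sub, h2, h3]
  have h5 : x * y * E x y (c * d) = x * c * y * (x * d * y) - c * (x * y) * (d * (x * y)) := by
    rw [E, mul_sub, h1, h4]
  rw [h5]
  simp only [E]
  noncomm_ring

theorem x_ypow (k : ℕ) : x * y ^ (k + 1) = y ^ k * x * y - (k : A) * y ^ k := by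
  have e : x * y = y * x - 1 := by rw [← hxy]; abel
  induction k with
  | zero => simp
  | succ k ih =>
    rw [pow_succ, ← mul_assoc, ih, sub_mul]
    have : y ^ k * x * y * y = y ^ (k + 1) * x * y - y ^ k * y := by
      rw [mul_assoc (y ^ k) x y, e]; noncomm_ring
    rw [this]; push_cast; rw [pow_succ]; noncomm_ring

theorem pow_lemma {n q p : ℤ} (hn : 0 < n) (hh : O.Ex n (y * x)) (M : ℤ) (hM : M ≤ n - 1)
    (H : ∀ c m, y * x * c = c * (y * x) → c ∈ O.F m → E x y c ∈ O.F (m + M))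
    {c : A} {m : ℤ} (hc : y * x * c = c * (y * x)) (hm : c ∈ O.F m) (j : ℕ) :
    E x y (c ^ j) - (j : K) • (c ^ (j - 1) * E x y c) ∈ O.F (j * m + M - 1) := by
  have e : x * y = y * x - 1 := by rw [← hxy]; abel
  have hg : O.Ex n (x * y) := hh.congr (by
    rw [e]; simpa using O.mono O.one_mem (by omega))
  have hcp : ∀ j : ℕ, c ^ j ∈ O.F (j * m) := by
    intro j
    induction j with
    | zero => simpa using O.one_mem
    | succ j ih => rw [pow_succ]; exact O.mono (O.mul ih hm) (by push_cast; linarith)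
  induction j with
  | zero => simp [E]
  | succ j ih =>
    have hcj : y * x * c ^ j = c ^ j * (y * x) := (show Commute (y * x) c from hc).pow_right j
    have h1 : E x y (c * c ^ j) - E x y c * c ^ j - c * E x y (c ^ j) ∈
        O.F ((j + 1 : ℕ) * m + M - 1) := by
      apply O.ex_of_mul hg
      rw [E_mul hxy hc hcj]
      refine O.mono (O.mul (H _ _ hc hm) (H _ _ hcj (hcp j))) ?_
      push_cast; linarith
    have h2 : E x y c * c ^ j - c ^ j * E x y c ∈ O.F ((j + 1 : ℕ) * m + M - 1) := by
      refine O.mono (O.comm (H _ _ hc hm) (hcp j)) ?_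
      push_cast; linarith
    have h3 : c * (E x y (c ^ j) - (j : K) • (c ^ (j - 1) * E x y c)) ∈
        O.F ((j + 1 : ℕ) * m + M - 1) := by
      refine O.mono (O.mul hm ih) ?_
      push_cast; linarith
    have h4 : c * ((j : K) • (c ^ (j - 1) * E x y c)) = (j : K) • (c ^ j * E x y c) := by
      rcases j with _ | j
      · simp
      · simp [pow_succ', mul_assoc]
    rw [mul_sub, h4] at h3
    have := add_mem (add_mem h1 h2) h3
    convert this using 1
    rw [← pow_succ']; push_cast; rw [add_smul, one_smul]; abel

theorem excess {n q p : ℤ} (hn : 0 < n) (hx : O.Ex p x) (hy : O.Ex q y) (hpq : p + q = n)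
    (hh : O.Ex n (y * x)) (t : ℕ) (ht : t < n) :
    ∀ c m, y * x * c = c * (y * x) → c ∈ O.F m → E x y c ∈ O.F (m + (n - 1 - t)) := by
  have e : x * y = y * x - 1 := by rw [← hxy]; abel
  induction t with
  | zero =>
    intro c m hc hm
    have : E x y c = (x * c - c * x) * y := by simp only [E]; noncomm_ring
    rw [this]
    refine O.mono (O.mul (O.comm hx.1 hm) hy.1) ?_
    push_cast; linarith
  | succ t ih =>
    push_cast at ht
    have H := ih (by omega)
    intro c m hc hm
    by_cases hm' : c ∈ O.F (m - 1)
    · exact O.mono (H c (m - 1) hc hm') (by push_cast; linarith)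
    by_contra hE
    have hEx : O.Ex (m + (n - 1 - t)) (E x y c) := ⟨H c m hc hm, fun h => hE (O.mono h (by push_cast; linarith))⟩
    have hcx : O.Ex m c := ⟨hm, hm'⟩
    lift m to ℕ using hcx.nonneg
    lift n to ℕ using hn.le
    have P1 := O.pow_lemma (q := q) (p := p) hxy hn hh (n - 1 - t) (by omega) H hc hm n
    have P2 := O.pow_lemma (q := q) (p := p) hxy hn hh (n - 1 - t) (by omega) H rfl hh.1 m
    have hcn : y * x * c ^ n = c ^ n * (y * x) := (show Commute (y * x) c from hc).pow_right n
    have hhm : y * x * (y * x) ^ m = (y * x) ^ m * (y * x) := (Commute.refl (y * x)).pow_right m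
    obtain ⟨l, hl⟩ := O.onedim hn hh.1 hh.2 (n * m) (c ^ n) ((y * x) ^ m) hcn hhm (hcx.pow n).1
      (O.mono (hh.pow m).1 (by linarith)) (fun h => (hh.pow m).2 (O.mono h (by linarith)))
    have h1 := H _ _ (by rw [mul_sub, sub_mul, hcn, mul_smul_comm, hhm, smul_mul_assoc]) hl
    rw [E_sub, E_smul] at h1
    have Eh : E x y (y * x) = -(x * y) := by
      have : E x y (y * x) = x * y * (x * y) - (y * x) * (x * y) := by simp only [E]; noncomm_ring
      rw [this, ← sub_mul, e]; noncomm_ring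
    have h2 : E x y ((y * x) ^ m) ∈ O.F (n * m + (n - 1 - t) - 1) := by
      have : (m : K) • ((y * x) ^ (m - 1) * E x y (y * x)) ∈ O.F (n * m) := by
        rcases m with _ | m
        · simp
        · apply Submodule.smul_mem
          rw [Eh, mul_neg]
          apply neg_mem
          have hg : x * y ∈ O.F n := O.mono (O.mul hx.1 hy.1) hpq.le
          refine O.mono (O.mul (hh.pow m).1 hg) ?_
          push_cast; linarith
      have := add_mem (O.mono P2 (show _ ≤ (n * m + (n - 1 - t) - 1 : ℤ) by linarith)) (O.mono this (show _ ≤ (n * m + (n - 1 - t) - 1 : ℤ) by linarith))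
      simpa using this
    have h3 : E x y (c ^ n) ∈ O.F (n * m + (n - 1 - t) - 1) := by
      have := add_mem (O.mono h1 (show _ ≤ (n * m + (n - 1 - t) - 1 : ℤ) by linarith)) (Submodule.smul_mem _ l h2)
      simpa using this
    have h4 := sub_mem h3 P1
    rw [sub_sub_cancel] at h4
    have hn0 : (n : K) ≠ 0 := by
      have : n ≠ 0 := by omega
      exact_mod_cast this
    refine (((hcx.pow (n - 1)).mul hEx).smul hn0).2 (O.mono h4 ?_)
    have : ((n - 1 : ℕ) : ℤ) = n - 1 := by omega
    rw [this]; linarith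

theorem lead {n q p : ℤ} (hn : 0 < n) (hx : O.Ex p x) (hy : O.Ex q y) (hpq : p + q = n)
    (hh : O.Ex n (y * x)) {c : A} {m : ℤ} (hc : y * x * c = c * (y * x)) (hcx : O.Ex m c) :
    E x y c + ((m : K) / n) • c ∈ O.F (m - 1) := by
  have e : x * y = y * x - 1 := by rw [← hxy]; abel
  have H : ∀ c m, y * x * c = c * (y * x) → c ∈ O.F m → E x y c ∈ O.F (m + 0) := by
    have := O.excess hxy hn hx hy hpq hh (n - 1).toNat (by omega)
    intro c m hc hm
    exact O.mono (this c m hc hm) (by omega)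
  obtain ⟨mu, hmu⟩ := O.onedim hn hh.1 hh.2 m (E x y c) c (E_comm hxy hc) hc
    (O.mono (H c m hc hcx.1) (by omega)) hcx.1 hcx.2
  suffices hs : (n : K) * mu + m = 0 by
    have hn0 : (n : K) ≠ 0 := by exact_mod_cast hn.ne'
    have : (m : K) / n = - mu := by field_simp; linear_combination hs
    rw [this]; simpa [sub_eq_add_neg] using hmu
  lift m to ℕ using hcx.nonneg
  lift n to ℕ using hn.le
  have P1 := O.pow_lemma (q := q) (p := p) hxy hn hh 0 (by omega) H hc hcx.1 n
  have P2 := O.pow_lemma (q := q) (p := p) hxy hn hh 0 (by omega) H rfl hh.1 m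
  have hcn : y * x * c ^ n = c ^ n * (y * x) := (show Commute (y * x) c from hc).pow_right n
  have hhm : y * x * (y * x) ^ m = (y * x) ^ m * (y * x) := (Commute.refl (y * x)).pow_right m
  obtain ⟨l, hl⟩ := O.onedim hn hh.1 hh.2 (n * m) (c ^ n) ((y * x) ^ m) hcn hhm (hcx.pow n).1
    (O.mono (hh.pow m).1 (by linarith)) (fun h => (hh.pow m).2 (O.mono h (by linarith)))
  have h1 := H _ _ (by rw [mul_sub, sub_mul, hcn, mul_smul_comm, hhm, smul_mul_assoc]) hl
  rw [E_sub, E_smul] at h1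
  have Eh : E x y (y * x) = -(y * x) + 1 := by
    have : E x y (y * x) = x * y * (x * y) - (y * x) * (x * y) := by simp only [E]; noncomm_ring
    rw [this, ← sub_mul, e]; noncomm_ring
  have h2 : E x y ((y * x) ^ m) + (m : K) • (y * x) ^ m ∈ O.F (n * m - 1) := by
    have h5 : (m : K) • (y * x) ^ (m - 1) ∈ O.F (n * m - 1) := by
      rcases m with _ | m
      · simp
      · apply Submodule.smul_mem
        refine O.mono (hh.pow m).1 ?_
        push_cast; linarith
    have h6 : (m : K) • ((y * x) ^ (m - 1) * E x y (y * x)) =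
        (m : K) • (y * x) ^ (m - 1) - (m : K) • (y * x) ^ m := by
      rcases m with _ | m
      · simp
      · rw [Eh, ← smul_sub, pow_succ]; congr 1; simp [mul_add]; abel
    rw [h6] at P2
    have := add_mem (O.mono P2 (show _ ≤ (n * m - 1 : ℤ) by linarith)) h5
    convert this using 1; abel
  have h3 : c ^ (n - 1) * (E x y c - mu • c) ∈ O.F (n * m - 1) := by
    refine O.mono (O.mul (hcx.pow (n - 1)).1 hmu) ?_
    have : ((n - 1 : ℕ) : ℤ) = n - 1 := by omega
    rw [this]; linarith
  have h3' : c ^ (n - 1) * (E x y c - mu • c) = c ^ (n - 1) * E x y c - mu • c ^ n := by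
    rw [mul_sub, mul_smul_comm, ← pow_succ, Nat.sub_add_cancel (by omega)]
  rw [h3'] at h3
  by_contra hne
  refine ((hcx.pow n).smul hne).2 ?_
  have := O.F (n * m - 1)
  have s1 := Submodule.smul_mem _ (n : K) h3
  have s2 := Submodule.smul_mem _ l h2
  have s3 := Submodule.smul_mem _ (m : K) hl
  have P1' := O.mono P1 (show _ ≤ (n * m - 1 : ℤ) by linarith)
  have h1' := O.mono h1 (show _ ≤ (n * m - 1 : ℤ) by linarith)
  have := add_mem (sub_mem (add_mem s2 (sub_mem h1' P1')) s1) s3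
  convert this using 1
  simp only [Int.cast_natCast]
  module

theorem dvd_of {n q p : ℤ} (hn : 0 < n) (hx : O.Ex p x) (hy : O.Ex q y) (hpq : p + q = n)
    (hh : O.Ex n (y * x)) (hq : 0 < q) {c : A} {m : ℤ} (hc : y * x * c = c * (y * x))
    (hcx : O.Ex m c) : n ∣ m := by
  by_contra hd
  have key : ∀ k : ℕ, ∃ u : A, y * x * (u * y ^ k) = (u * y ^ k) * (y * x) ∧ O.Ex m (u * y ^ k) := by
    intro k
    induction k with
    | zero => exact ⟨c, by simpa using hc, by simpa using hcx⟩
    | succ k ih =>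
      obtain ⟨u, h1, h2⟩ := ih
      have hv : (x * u - u * x) * y ^ (k + 1) = E x y (u * y ^ k) + (k : K) • (u * y ^ k) := by
        rw [sub_mul, mul_assoc u, x_ypow hxy]
        have : (k : K) • (u * y ^ k) = u * ((k : A) * y ^ k) := by
          rw [← mul_smul_comm]; congr 1
          rw [Nat.cast_smul_eq_nsmul, nsmul_eq_mul]
        rw [this, E, pow_succ]; noncomm_ring
      refine ⟨x * u - u * x, ?_, ?_⟩
      · rw [hv, mul_add, add_mul, E_comm hxy h1, mul_smul_comm, h1, smul_mul_assoc]
      · rw [hv]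
        have hn0 : (n : K) ≠ 0 := by exact_mod_cast hn.ne'
        have hne : (k : K) - m / n ≠ 0 := by
          intro h
          field_simp at h
          have : (m : K) = ((n * k : ℤ) : K) := by push_cast; linear_combination -h
          have := Int.cast_injective this
          exact hd ⟨k, this⟩
        refine (h2.smul hne).congr ?_
        convert O.lead hxy hn hx hy hpq hh h1 h2 using 1
        module
  obtain ⟨u, -, hu⟩ := key (m.toNat + 1)
  have hu0 : u ≠ 0 := by
    rintro rfl
    exact hu.ne (by simp)
  obtain ⟨i, hi⟩ := O.exists_ex hu0
  have h1 := (hi.mul (hy.pow (m.toNat + 1))).unique hu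
  have := hi.nonneg
  have := hcx.nonneg
  have : ((m.toNat : ℕ) : ℤ) = m := by omega
  push_cast at h1
  rw [this] at h1
  nlinarith

theorem mem_adjoin_aux {n q p : ℤ} (hn : 0 < n) (hx : O.Ex p x) (hy : O.Ex q y) (hpq : p + q = n)
    (hh : O.Ex n (y * x)) (hq : 0 < q) (c : A) (hc : y * x * c = c * (y * x)) :
    c ∈ Algebra.adjoin K ({y * x} : Set A) := by
  obtain ⟨i, hi⟩ := O.exh c
  have key : ∀ k : ℕ, ∀ i : ℤ, i < k → ∀ c, y * x * c = c * (y * x) → c ∈ O.F i →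
      c ∈ Algebra.adjoin K ({y * x} : Set A) := by
    intro k
    induction k with
    | zero => intro i hi c _ h; rw [O.neg h (by simpa using hi)]; exact zero_mem _
    | succ k ih =>
      intro i hi c hc h
      push_cast at hi
      by_cases h' : c ∈ O.F (i - 1)
      · exact ih (i - 1) (by omega) c hc h'
      have hcx : O.Ex i c := ⟨h, h'⟩
      obtain ⟨j, hj⟩ := O.dvd_of hxy hn hx hy hpq hh hq hc hcx
      have := hcx.nonneg
      have hj0 : 0 ≤ j := by
        by_contra hj0
        nlinarith
      lift j to ℕ using hj0
      have hhm : y * x * (y * x) ^ j = (y * x) ^ j * (y * x) := (Commute.refl (y * x)).pow_right j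
      have hp := hh.pow j
      rw [show (j : ℤ) * n = i by rw [hj]; ring] at hp
      obtain ⟨l, hl⟩ := O.onedim hn hh.1 hh.2 i c ((y * x) ^ j) hc hhm h hp.1 hp.2
      have h1 := ih (i - 1) (by omega) _
        (by rw [mul_sub, sub_mul, hc, mul_smul_comm, hhm, smul_mul_assoc]) hl
      have h2 : l • (y * x) ^ j ∈ Algebra.adjoin K ({y * x} : Set A) :=
        Subalgebra.smul_mem _ (pow_mem (Algebra.self_mem_adjoin_singleton K (y * x)) j) l
      have := add_mem h1 h2
      simpa using this
  exact key (i.toNat + 1) i (by push_cast; omega) c hc hi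

theorem mem_adjoin (O : OrdFilt K A) {c : A} (hc : y * x * c = c * (y * x)) :
    c ∈ Algebra.adjoin K ({y * x} : Set A) := by
  have hx0 : x ≠ 0 := by
    rintro rfl; exact O.one_ne (by simpa using hxy.symm)
  have hy0 : y ≠ 0 := by
    rintro rfl; exact O.one_ne (by simpa using hxy.symm)
  obtain ⟨p, hx⟩ := O.exists_ex hx0
  obtain ⟨q, hy⟩ := O.exists_ex hy0
  have hp := hx.nonneg
  have hq := hy.nonneg
  have hpq : 0 < p + q := by
    by_contra h
    have h1 := O.comm hy.1 hx.1
    rw [hxy] at h1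
    exact O.one_ne (O.neg h1 (by omega))
  have hh : O.Ex (p + q) (y * x) := by rw [add_comm]; exact hy.mul hx
  by_cases hq0 : 0 < q
  · exact O.mem_adjoin_aux hxy hpq hx hy rfl hh hq0 c hc
  · have e : x * y = y * x - 1 := by rw [← hxy]; abel
    have hxy' : (-x) * y - y * (-x) = 1 := by rw [← hxy]; noncomm_ring
    have hx' : O.Ex p (-x) := by
      simpa using hx.smul (l := (-1 : K)) (by simp)
    have hc' : (-x) * y * c = c * ((-x) * y) := by
      rw [neg_mul, e, neg_mul, mul_neg, sub_mul, mul_sub, hc]; simp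
    have := O.mem_adjoin_aux hxy' (n := p + q) hpq hy hx' (by omega) (hx'.mul hy) (by omega) c hc'
    refine Algebra.adjoin_le ?_ this
    rintro _ rfl
    have h1 : (-x) * y = 1 - y * x := by rw [neg_mul, e]; abel
    simp only [SetLike.mem_coe]
    rw [h1]
    exact sub_mem (OneMemClass.one_mem _) (Algebra.self_mem_adjoin_singleton K (y * x))

end
end OrdFilt

namespace WeylAux
open Polynomial
variable {K : Type*} [Field K]

theorem coeff_sumD (p : K[X][X]) (k : ℕ) :
    (p.sum fun i a => monomial i (derivative a)).coeff k = derivative (p.coeff k) := by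
  rw [Polynomial.sum_def, finsetSum_coeff]
  simp only [coeff_monomial]
  rw [Finset.sum_ite_eq']
  split_ifs with h
  · rfl
  · rw [notMem_support_iff.1 h]; simp

noncomputable def D : K[X][X] →ₗ[K] K[X][X] where
  toFun p := p.sum fun i a => monomial i (derivative a)
  map_add' p q := by ext1 k; simp only [coeff_add, coeff_sumD, derivative_add]
  map_smul' l p := by
    ext1 k; simp only [coeff_smul, coeff_sumD, RingHom.id_apply, derivative_smul]

theorem coeff_D (p : K[X][X]) (k : ℕ) : (D p).coeff k = derivative (p.coeff k) := coeff_sumD p k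

theorem D_C_mul (f : K[X]) (p : K[X][X]) : D (C f * p) = C f * D p + C (derivative f) * p := by
  ext1 k; simp [coeff_D]; ring

theorem D_X_mul (p : K[X][X]) : D (X * p) = X * D p := by
  ext1 k
  rcases k with _ | k
  · simp [coeff_D]
  · simp [coeff_D, coeff_X_mul]

theorem D_Xpow_mul (j : ℕ) (p : K[X][X]) : D (X ^ j * p) = X ^ j * D p := by
  induction j with
  | zero => simp
  | succ j ih => rw [pow_succ', mul_assoc, D_X_mul, ih]; ring

theorem D_natDegree {p : K[X][X]} {e : ℕ} (h : p.natDegree ≤ e) : (D p).natDegree ≤ e := by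
  rw [natDegree_le_iff_coeff_eq_zero] at h ⊢
  intro k hk
  rw [coeff_D, h k hk]; simp

noncomputable def opX : Module.End K K[X][X] := LinearMap.mulLeft K (C X)
noncomputable def opY : Module.End K K[X][X] := D + LinearMap.mulLeft K X

noncomputable def rho0 : FreeAlgebra K (Fin 2) →ₐ[K] Module.End K K[X][X] :=
  FreeAlgebra.lift K ![opX, opY]

noncomputable def rho : WeylAlgebra K →ₐ[K] Module.End K K[X][X] :=
  RingQuot.liftAlgHom K ⟨rho0, by
    rintro a b ⟨rfl, rfl⟩
    refine LinearMap.ext fun p => ?_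
    simp [rho0, opX, opY, D_C_mul]
    ring⟩

noncomputable def wx : WeylAlgebra K := RingQuot.mkAlgHom K (weylRel K) (FreeAlgebra.ι K 0)
noncomputable def wy : WeylAlgebra K := RingQuot.mkAlgHom K (weylRel K) (FreeAlgebra.ι K 1)

theorem wrel : (wy : WeylAlgebra K) * wx = wx * wy + 1 := by
  have := RingQuot.mkAlgHom_rel K (s := weylRel K) ⟨rfl, rfl⟩
  simpa [wx, wy] using this

theorem rho_wx (p : K[X][X]) : rho wx p = C X * p := by
  simp [rho, wx, rho0, opX]

theorem rho_wy (p : K[X][X]) : rho wy p = D p + X * p := by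
  simp [rho, wy, rho0, opY]

theorem wy_aeval (f : K[X]) : (wy : WeylAlgebra K) * aeval wx f =
    aeval wx f * wy + aeval wx (derivative f) := by
  induction f using Polynomial.induction_on' with
  | add p q hp hq => simp only [map_add, mul_add, add_mul, hp, hq]; abel
  | monomial n a =>
    rw [← C_mul_X_pow_eq_monomial]
    simp only [map_mul, aeval_C, map_pow, aeval_X, derivative_C_mul, derivative_X_pow, map_natCast]
    have : (wy : WeylAlgebra K) * wx ^ n = wx ^ n * wy + (n : WeylAlgebra K) * wx ^ (n - 1) := by
      induction n with
      | zero => simp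
      | succ n ih =>
        have h2 : ((n : WeylAlgebra K) * wx ^ (n - 1)) * wx = (n : WeylAlgebra K) * wx ^ n := by
          rcases n with _ | n
          · simp
          · rw [mul_assoc, ← pow_succ]; rfl
        rw [pow_succ, ← mul_assoc, ih, add_mul, h2, mul_assoc (wx ^ n), wrel]
        push_cast
        noncomm_ring
    rw [← mul_assoc, ← Algebra.commutes, mul_assoc, this, mul_add, mul_assoc]

noncomputable def S (a : WeylAlgebra K) : K[X][X] := rho a 1

noncomputable def N (p : K[X][X]) : WeylAlgebra K := p.sum fun i f => aeval wx f * wy ^ i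

theorem N_add (p q : K[X][X]) : N (p + q) = N p + N q :=
  Polynomial.sum_add_index _ _ _ (by simp) (by intros; simp [add_mul])

theorem N_mono (i : ℕ) (f : K[X]) : N (monomial i f) = aeval wx f * wy ^ i :=
  Polynomial.sum_monomial_index _ _ (by simp)

theorem N_X (p : K[X][X]) : N (C X * p) = wx * N p := by
  induction p using Polynomial.induction_on' with
  | add p q hp hq => rw [mul_add, N_add, N_add, hp, hq, mul_add]
  | monomial n f => rw [C_mul_monomial, N_mono, N_mono]; simp [mul_assoc]

theorem D_mono (n : ℕ) (f : K[X]) : D (monomial n f) = monomial n (derivative f) := by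
  ext1 k; rw [coeff_D, coeff_monomial, coeff_monomial]; split_ifs <;> simp

theorem N_Y (p : K[X][X]) : N (D p + X * p) = wy * N p := by
  induction p using Polynomial.induction_on' with
  | add p q hp hq =>
    rw [map_add, mul_add, add_add_add_comm, N_add, hp, hq, N_add, mul_add]
  | monomial n f =>
    rw [D_mono, X_mul_monomial, N_add, N_mono, N_mono, N_mono, ← mul_assoc, wy_aeval, pow_succ']
    noncomm_ring

theorem N_S (a : WeylAlgebra K) : N (S a) = a := by
  have key : ∀ (b : FreeAlgebra K (Fin 2)) (w : WeylAlgebra K), N (S w) = w →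
      N (S (RingQuot.mkAlgHom K (weylRel K) b * w)) = RingQuot.mkAlgHom K (weylRel K) b * w := by
    intro b
    induction b using FreeAlgebra.induction with
    | grade0 r =>
      intro w hw
      have h : ∀ p : K[X][X], N (r • p) = r • N p := by
        intro p
        induction p using Polynomial.induction_on' with
        | add p q hp hq => rw [smul_add, N_add, N_add, hp, hq, smul_add]
        | monomial n f => rw [smul_monomial, N_mono, N_mono]; simp
      rw [AlgHom.commutes, ← Algebra.smul_def]
      simp only [S, map_smul, LinearMap.smul_apply]
      rw [h]; congr 1
    | grade1 i =>
      intro w hw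
      fin_cases i
      · change N (S (wx * w)) = wx * w
        rw [S, map_mul, Module.End.mul_apply, rho_wx, N_X]; congr 1
      · change N (S (wy * w)) = wy * w
        rw [S, map_mul, Module.End.mul_apply, rho_wy, N_Y]; congr 1
    | mul a b ha hb => intro w hw; rw [map_mul, mul_assoc]; exact ha _ (hb _ hw)
    | add a b ha hb =>
      intro w hw
      rw [map_add, add_mul]
      have : ∀ u v : WeylAlgebra K, S (u + v) = S u + S v := by intro u v; simp [S]
      rw [this, N_add, ha _ hw, hb _ hw]
  obtain ⟨b, rfl⟩ := RingQuot.mkAlgHom_surjective K (weylRel K) a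
  have h1 : N (S (1 : WeylAlgebra K)) = 1 := by
    simp only [S, map_one, Module.End.one_apply]
    rw [show (1 : K[X][X]) = monomial 0 1 from rfl, N_mono]; simp
  simpa using key b 1 h1

theorem S_mul (a b : WeylAlgebra K) : S (a * b) = rho a (S b) := by
  simp [S]

theorem S_add (a b : WeylAlgebra K) : S (a + b) = S a + S b := by simp [S]
theorem S_sub (a b : WeylAlgebra K) : S (a - b) = S a - S b := by simp [S]
theorem S_smul (l : K) (a : WeylAlgebra K) : S (l • a) = l • S a := by simp [S]

theorem rho_aeval (f : K[X]) (p : K[X][X]) : rho (aeval wx f) p = C f * p := by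
  induction f using Polynomial.induction_on' with
  | add a b ha hb => simp [ha, hb, add_mul]
  | monomial n a =>
    rw [← C_mul_X_pow_eq_monomial]
    simp only [map_mul, aeval_C, map_pow, aeval_X, Module.End.mul_apply, AlgHom.commutes,
      Module.algebraMap_end_apply]
    have : ((rho wx : Module.End K K[X][X]) ^ n) p = C X ^ n * p := by
      induction n with
      | zero => simp
      | succ n ih => rw [pow_succ', Module.End.mul_apply, ih, rho_wx]; ring
    rw [this]
    ext1 k
    simp [mul_assoc, Polynomial.smul_eq_C_mul, ← C_pow, -map_pow]

theorem ypow_exp (g : K[X][X]) (e : ℕ) (hg : g.natDegree ≤ e) (j : ℕ) :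
    ∃ R : K[X][X], ((rho wy : Module.End K K[X][X]) ^ j) g =
      X ^ j * g + derivative (X ^ j) * D g + R ∧ ∀ k, j + e < k + 2 → R.coeff k = 0 := by
  induction j with
  | zero => exact ⟨0, by simp, by simp⟩
  | succ j ih =>
    obtain ⟨R, h1, h2⟩ := ih
    refine ⟨derivative (X ^ j) * D (D g) + X * R + D R, ?_, ?_⟩
    · rw [pow_succ', Module.End.mul_apply, h1, rho_wy, map_add, map_add, D_Xpow_mul]
      have : D (derivative (X ^ j) * D g) = derivative (X ^ j) * D (D g) := by
        rw [derivative_X_pow]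
        have : (C (j : K[X]) : K[X][X]) * X ^ (j - 1) * D g = j • (X ^ (j - 1) * D g) := by
          simp [mul_assoc]
        rw [this, map_nsmul, D_Xpow_mul]; simp [mul_assoc]
      rw [this, pow_succ' X j, derivative_mul, derivative_X]
      ring
    · intro k hk
      have h3 : (derivative (X ^ j) * D (D g)).coeff k = 0 := by
        rcases j with _ | j
        · simp
        · apply coeff_eq_zero_of_natDegree_lt
          refine lt_of_le_of_lt natDegree_mul_le ?_
          have := D_natDegree (D_natDegree hg)
          have h4 := natDegree_derivative_le (X ^ (j + 1) : K[X][X])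
          rw [natDegree_X_pow] at h4
          omega
      have h5 : (X * R).coeff k = 0 := by
        rcases k with _ | k
        · simp
        · rw [coeff_X_mul]; exact h2 k (by omega)
      rw [coeff_add, coeff_add, h3, h5, coeff_D, h2 k (by omega)]; simp

theorem expand (a : WeylAlgebra K) (g : K[X][X]) (m e : ℕ) (hm : (S a).natDegree ≤ m)
    (hg : g.natDegree ≤ e) (k : ℕ) (hk : m + e < k + 2) :
    (rho a g).coeff k = (S a * g + derivative (S a) * D g).coeff k := by
  choose R h1 h2 using ypow_exp g e hg
  have ha : rho a g = ∑ i ∈ Finset.range (m + 1), C ((S a).coeff i) * (((rho wy : Module.End K K[X][X]) ^ i) g) := by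
    conv_lhs => rw [← N_S a]
    rw [N, Polynomial.sum_over_range' _ (by simp) (m + 1) (by omega)]
    simp [rho_aeval]
  have hs : S a = ∑ i ∈ Finset.range (m + 1), C ((S a).coeff i) * X ^ i :=
    as_sum_range_C_mul_X_pow' _ (by omega)
  have h3 : S a * g + derivative (S a) * D g = ∑ i ∈ Finset.range (m + 1),
      C ((S a).coeff i) * (X ^ i * g + derivative (X ^ i) * D g) := by
    conv_lhs => rw [hs]
    rw [derivative_sum, Finset.sum_mul, Finset.sum_mul, ← Finset.sum_add_distrib]
    refine Finset.sum_congr rfl fun i _ => ?_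
    rw [derivative_C_mul]; ring
  rw [ha, h3, finsetSum_coeff, finsetSum_coeff]
  refine Finset.sum_congr rfl fun i hi => ?_
  rw [Finset.mem_range] at hi
  rw [h1, coeff_C_mul, coeff_C_mul, coeff_add, h2 i k (by omega), add_zero]

theorem coeff_dmul {p q : K[X][X]} {m e k : ℕ} (hp : p.natDegree ≤ m) (hq : q.natDegree ≤ e)
    (hk : m + e ≤ k) : (derivative p * q).coeff k = 0 := by
  rcases m with _ | m
  · rw [eq_C_of_natDegree_le_zero hp]; simp
  · apply coeff_eq_zero_of_natDegree_lt
    refine lt_of_le_of_lt natDegree_mul_le ?_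
    have h4 := natDegree_derivative_le p
    omega

theorem coeff_dmul' {p q : K[X][X]} {m e k : ℕ} (hp : p.natDegree ≤ m) (hq : q.natDegree ≤ e)
    (hk : m + e = k + 1) : (derivative p * q).coeff k = m * p.coeff m * q.coeff e := by
  rcases m with _ | m
  · rw [eq_C_of_natDegree_le_zero hp]; simp
  · have h4 := natDegree_derivative_le p
    obtain rfl : k = m + e := by omega
    rw [coeff_mul_add_eq_of_natDegree_le (by omega) hq, coeff_derivative]
    push_cast; ring

theorem comm_coeff (a b : WeylAlgebra K) (m e : ℕ) (ha : (S a).natDegree ≤ m)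
    (hb : (S b).natDegree ≤ e) (k : ℕ) (hk : m + e < k + 2) :
    (S (a * b - b * a)).coeff k =
      (derivative (S a) * D (S b)).coeff k - (derivative (S b) * D (S a)).coeff k := by
  rw [S_sub, coeff_sub, S_mul, S_mul, expand a _ m e ha hb k hk, expand b _ e m hb ha k (by omega),
    coeff_add, coeff_add, mul_comm (S b)]
  ring

theorem ode_degree [CharZero K] {n m : ℕ} {al be : K[X]} (ha : al ≠ 0) (hb : be ≠ 0)
    (h : (n : K[X]) * al * derivative be = (m : K[X]) * be * derivative al) :
    n * be.natDegree = m * al.natDegree := by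
  have hX : ∀ p : K[X], (X * derivative p).natDegree ≤ p.natDegree ∧
      (X * derivative p).coeff p.natDegree = p.natDegree * p.leadingCoeff := by
    intro p
    by_cases h0 : p.natDegree = 0
    · rw [eq_C_of_natDegree_eq_zero h0]; simp
    · obtain ⟨d, hd⟩ := Nat.exists_eq_succ_of_ne_zero h0
      constructor
      · refine natDegree_mul_le.trans ?_
        have := natDegree_derivative_le p
        simp only [natDegree_X]; omega
      · rw [leadingCoeff, hd, Nat.succ_eq_add_one, coeff_X_mul, coeff_derivative]; push_cast; ring
  have h2 : (n : K[X]) * (al * (X * derivative be)) = (m : K[X]) * (be * (X * derivative al)) := by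
    linear_combination X * h
  have h3 := congrArg (fun p => p.coeff (al.natDegree + be.natDegree)) h2
  simp only [← C_eq_natCast, coeff_C_mul] at h3
  rw [coeff_mul_add_eq_of_natDegree_le le_rfl (hX be).1, (hX be).2, add_comm al.natDegree,
    coeff_mul_add_eq_of_natDegree_le le_rfl (hX al).1, (hX al).2] at h3
  have ha' := leadingCoeff_ne_zero.2 ha
  have hb' := leadingCoeff_ne_zero.2 hb
  have h4 : ((n * be.natDegree : ℕ) : K) = ((m * al.natDegree : ℕ) : K) := by
    apply mul_right_cancel₀ (mul_ne_zero ha' hb')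
    push_cast
    simp only [leadingCoeff] at *
    linear_combination h3
  exact_mod_cast h4

def Fil (i : ℤ) : Submodule K (WeylAlgebra K) where
  carrier := {a | ∀ k : ℕ, i < k → (S a).coeff k = 0}
  add_mem' := by
    intro a b ha hb k hk
    rw [S_add, coeff_add, ha k hk, hb k hk, add_zero]
  zero_mem' := by intro k _; simp [S]
  smul_mem' := by
    intro l a ha k hk
    rw [S_smul, coeff_smul, ha k hk, smul_zero]

theorem mem_Fil {i : ℤ} {a : WeylAlgebra K} :
    a ∈ Fil i ↔ ∀ k : ℕ, i < k → (S a).coeff k = 0 := Iff.rfl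

theorem mem_Fil_nat {i : ℕ} {a : WeylAlgebra K} : a ∈ Fil (i : ℤ) ↔ (S a).natDegree ≤ i := by
  rw [mem_Fil, natDegree_le_iff_coeff_eq_zero]
  simp

theorem Fil_neg {i : ℤ} {a : WeylAlgebra K} (h : a ∈ Fil i) (hi : i < 0) : a = 0 := by
  have : S a = 0 := by
    ext1 k; rw [coeff_zero]; exact h k (by omega)
  rw [← N_S a, this]; simp [N]

theorem Fil_ex {i : ℕ} {a : WeylAlgebra K} (ha : a ∈ Fil (i : ℤ)) :
    a ∈ Fil ((i : ℤ) - 1) ↔ (S a).coeff i = 0 := by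
  constructor
  · intro h; exact h i (by omega)
  · intro h k hk
    by_cases hik : k = i
    · rw [hik, h]
    · exact ha k (by omega)

theorem ode_of_comm {h c : WeylAlgebra K} {n m : ℕ} (hn : 0 < n) (hh : (S h).natDegree ≤ n)
    (hc : (S c).natDegree ≤ m) (hcomm : h * c = c * h) :
    (n : K[X]) * (S h).coeff n * derivative ((S c).coeff m) =
      (m : K[X]) * (S c).coeff m * derivative ((S h).coeff n) := by
  have h1 := comm_coeff h c n m hh hc (n + m - 1) (by omega)
  rw [hcomm, sub_self, coeff_dmul' hh (D_natDegree hc) (by omega),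
    coeff_dmul' hc (D_natDegree hh) (by omega), coeff_D, coeff_D] at h1
  have : S (0 : WeylAlgebra K) = 0 := by simp [S]
  rw [this, coeff_zero] at h1
  linear_combination -h1

noncomputable def ordFilt [CharZero K] : OrdFilt K (WeylAlgebra K) where
  F := Fil
  mono := fun h hij k hk => h k (by omega)
  neg := Fil_neg
  exh := fun a => ⟨(S a).natDegree, mem_Fil_nat.2 le_rfl⟩
  one_mem := by
    have : (S (1 : WeylAlgebra K)).natDegree ≤ 0 := by simp [S]
    exact mem_Fil_nat.2 this
  one_ne := by
    intro h
    have : S (1 : WeylAlgebra K) = 0 := by rw [h]; simp [S]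
    simp [S] at this
  mul := by
    intro i j a b ha hb
    rcases lt_or_ge i 0 with hi | hi
    · rw [Fil_neg ha hi, zero_mul]; exact zero_mem _
    rcases lt_or_ge j 0 with hj | hj
    · rw [Fil_neg hb hj, mul_zero]; exact zero_mem _
    lift i to ℕ using hi
    lift j to ℕ using hj
    intro k hk
    have ha' := mem_Fil_nat.1 ha
    have hb' := mem_Fil_nat.1 hb
    rw [S_mul, expand a _ i j ha' hb' k (by omega), coeff_add,
      coeff_dmul ha' (D_natDegree hb') (by omega), add_zero]
    apply coeff_eq_zero_of_natDegree_lt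
    refine lt_of_le_of_lt natDegree_mul_le ?_
    omega
  comm := by
    intro i j a b ha hb
    rcases lt_or_ge i 0 with hi | hi
    · rw [Fil_neg ha hi, zero_mul, mul_zero, sub_zero]; exact zero_mem _
    rcases lt_or_ge j 0 with hj | hj
    · rw [Fil_neg hb hj, zero_mul, mul_zero, sub_zero]; exact zero_mem _
    lift i to ℕ using hi
    lift j to ℕ using hj
    intro k hk
    have ha' := mem_Fil_nat.1 ha
    have hb' := mem_Fil_nat.1 hb
    rw [comm_coeff a b i j ha' hb' k (by omega), coeff_dmul ha' (D_natDegree hb') (by omega),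
      coeff_dmul hb' (D_natDegree ha') (by omega), sub_zero]
  exmul := by
    intro i j a b ha ha1 hb hb1 hab
    rcases lt_or_ge i 0 with hi | hi
    · rw [Fil_neg ha hi] at ha1; exact ha1 (zero_mem _)
    rcases lt_or_ge j 0 with hj | hj
    · rw [Fil_neg hb hj] at hb1; exact hb1 (zero_mem _)
    lift i to ℕ using hi
    lift j to ℕ using hj
    have ha' := mem_Fil_nat.1 ha
    have hb' := mem_Fil_nat.1 hb
    rw [Fil_ex ha] at ha1
    rw [Fil_ex hb] at hb1
    have := hab (i + j) (by push_cast; omega)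
    rw [S_mul, expand a _ i j ha' hb' _ (by omega), coeff_add,
      coeff_dmul ha' (D_natDegree hb') (by omega), add_zero,
      coeff_mul_add_eq_of_natDegree_le ha' hb'] at this
    exact (mul_ne_zero ha1 hb1) this
  onedim := by
    intro h n hn hh hh1 m c d hc hd hcm hdm hdm1
    rcases lt_or_ge m 0 with hm | hm
    · rw [Fil_neg hdm hm] at hdm1; exact absurd (zero_mem _) hdm1
    lift m to ℕ using hm
    lift n to ℕ using hn.le
    have hn' : 0 < n := by omega
    rw [Fil_ex hh] at hh1
    rw [Fil_ex hdm] at hdm1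
    have od := ode_degree hh1 hdm1 (ode_of_comm hn' (mem_Fil_nat.1 hh) (mem_Fil_nat.1 hdm) hd)
    have key : ∀ e, h * e = e * h → e ∈ Fil (m : ℤ) → (S e).coeff m ≠ 0 →
        ((S e).coeff m).natDegree = ((S d).coeff m).natDegree := by
      intro e he hem he0
      have oe := ode_degree hh1 he0 (ode_of_comm hn' (mem_Fil_nat.1 hh) (mem_Fil_nat.1 hem) he)
      exact Nat.eq_of_mul_eq_mul_left hn' (oe.trans od.symm)
    by_cases hc0 : (S c).coeff m = 0
    · exact ⟨0, by rw [zero_smul, sub_zero, Fil_ex hcm]; exact hc0⟩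
    set f := (S c).coeff m with hf
    set g := (S d).coeff m with hg
    set l := f.leadingCoeff / g.leadingCoeff with hl
    have hlg : g.leadingCoeff ≠ 0 := leadingCoeff_ne_zero.2 hdm1
    have hlf : f.leadingCoeff ≠ 0 := leadingCoeff_ne_zero.2 hc0
    have hl0 : l ≠ 0 := div_ne_zero hlf hlg
    refine ⟨l, ?_⟩
    have hem : c - l • d ∈ Fil (m : ℤ) := sub_mem hcm (Submodule.smul_mem _ _ hdm)
    rw [Fil_ex hem]
    by_contra hne
    have h1 := key _ (by rw [mul_sub, sub_mul, hc, mul_smul_comm, hd, smul_mul_assoc]) hem hne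
    have h2 := key c hc hcm hc0
    have hS : (S (c - l • d)).coeff m = f - l • g := by
      rw [S_sub, S_smul, coeff_sub, coeff_smul]
    rw [hS] at h1 hne
    have hdeg : f.degree = (l • g).degree := by
      rw [degree_smul_of_smul_regular _ (IsSMulRegular.of_ne_zero hl0), degree_eq_natDegree hc0,
        degree_eq_natDegree hdm1, h2]
    have hlead : f.leadingCoeff = (l • g).leadingCoeff := by
      rw [smul_eq_C_mul, leadingCoeff_mul, leadingCoeff_C, hl]; field_simp
    have h3 := degree_sub_lt_left hdeg hc0 hlead
    have h4 := natDegree_lt_natDegree hne h3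
    rw [← hf] at h2
    rw [h1, h2] at h4
    exact lt_irrefl _ h4

end WeylAux

/-- **Theorem 1.1.** If `[y,x] = 1` for elements `x, y` of the Weyl algebra `A₁` over a
field `K` of characteristic zero, then the centralizer `C(yx)` of `yx` in `A₁` equals the
polynomial subalgebra `K[yx]` generated by `yx`. -/
theorem centralizer_yx_eq_adjoin (K : Type*) [Field K] [CharZero K]
    (x y : WeylAlgebra K) (hxy : y * x - x * y = 1) :
    Subalgebra.centralizer K ({y * x} : Set (WeylAlgebra K)) =
      Algebra.adjoin K ({y * x} : Set (WeylAlgebra K)) := by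
  apply le_antisymm
  · intro c hc
    rw [Subalgebra.mem_centralizer_iff] at hc
    exact OrdFilt.mem_adjoin hxy WeylAux.ordFilt (hc _ rfl)
  · apply Algebra.adjoin_le
    rintro _ rfl
    rw [SetLike.mem_coe, Subalgebra.mem_centralizer_iff]
    rintro _ rfl
    rfl
end

section
/- If x and y are elements of the first Weyl algebra A₁ over a field K of characteristic zero such that [y,x] = 1, then the eigenvector algebra D(yx) equals the subalgebra K⟨x,y⟩ of A₁ generated by x and y; in particular, the set of eigenvalues of the inner derivation ad(yx) on A₁ is exactly ℤ, and for each i ∈ ℤ the eigenspace ker(ad(yx) − i) equals K[yx]·xⁱ if i ≥ 0 and K[yx]·y^{−i} if i < 0. -/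
open Polynomial

/-- Symbol data: an order filtration with symbol calculus on a `K`-algebra. -/
structure SymData (K A : Type*) [Field K] [Ring A] [Algebra K A] where
  s : A →ₗ[K] Polynomial (Polynomial K)
  inj : Function.Injective s
  one : s 1 = 1
  deg_le : ∀ a b m n, (s a).natDegree ≤ m → (s b).natDegree ≤ n → (s (a * b)).natDegree ≤ m + n
  mul0 : ∀ a b m n, (s a).natDegree ≤ m → (s b).natDegree ≤ n →
    (s (a * b)).coeff (m + n) = (s a).coeff m * (s b).coeff n
  mul1 : ∀ a b m n k, (s a).natDegree ≤ m → (s b).natDegree ≤ n → k + 1 = m + n →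
    (s (a * b)).coeff k = (s a * s b).coeff k
      + (m : Polynomial K) * (s a).coeff m * derivative ((s b).coeff n)
  G : ℕ → Submodule K A
  Gfin : ∀ n, ∃ t : Finset A, t.card ≤ (n + 1) ^ 2 ∧ G n ≤ Submodule.span K (t : Set A)
  Gmono : Monotone G
  Gone : ∀ n, 1 ∈ G n
  Gmul : ∀ m n a b, a ∈ G m → b ∈ G n → a * b ∈ G (m + n)
  Gex : ∀ a, ∃ n, a ∈ G n

namespace WeylSym

section
variable (K : Type*) [Field K]

noncomputable def dX : K[X][X] →ₗ[K] K[X][X] :=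
  Polynomial.lsum (fun n => ((monomial n : K[X] →ₗ[K[X]] K[X][X]).restrictScalars K) ∘ₗ
    (derivative : K[X] →ₗ[K] K[X]))

lemma dX_monomial (n : ℕ) (c : K[X]) : dX K (monomial n c) = monomial n (derivative c) := by
  simp [dX, Polynomial.lsum, Polynomial.sum_monomial_index]

lemma coeff_dX (g : K[X][X]) (k : ℕ) : (dX K g).coeff k = derivative (g.coeff k) := by
  induction g using Polynomial.induction_on' with
  | add p q hp hq => simp [hp, hq]
  | monomial n c =>
    rw [dX_monomial, coeff_monomial, coeff_monomial]
    split_ifs <;> simp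

noncomputable def mX : K[X][X] →ₗ[K] K[X][X] := LinearMap.mulLeft K (C X)
noncomputable def th : K[X][X] →ₗ[K] K[X][X] := LinearMap.mulLeft K X + dX K

lemma th_mX : th K * mX K = mX K * th K + 1 := by
  ext g k : 2
  · simp only [th, mX, Module.End.mul_apply, LinearMap.add_apply, LinearMap.mulLeft_apply,
      Module.End.one_apply, coeff_add, coeff_C_mul, coeff_dX, derivative_mul, derivative_X, mul_add]
    have : (X * (C X * g) : K[X][X]) = C X * (X * g) := by ring
    rw [this, coeff_C_mul]; ring

noncomputable def WX : WeylAlgebra K := RingQuot.mkAlgHom K (weylRel K) (FreeAlgebra.ι K 0)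
noncomputable def WY : WeylAlgebra K := RingQuot.mkAlgHom K (weylRel K) (FreeAlgebra.ι K 1)

lemma WYX : WY K * WX K = WX K * WY K + 1 := by
  have := RingQuot.mkAlgHom_rel K (s := weylRel K) (x := FreeAlgebra.ι K 1 * FreeAlgebra.ι K 0)
    (y := FreeAlgebra.ι K 0 * FreeAlgebra.ι K 1 + 1) ⟨rfl, rfl⟩
  simpa [WX, WY] using this

noncomputable def rho : WeylAlgebra K →ₐ[K] Module.End K (K[X][X]) :=
  RingQuot.liftAlgHom K ⟨FreeAlgebra.lift K ![mX K, th K], by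
    rintro a b ⟨rfl, rfl⟩
    simpa using th_mX K⟩

lemma rho_X : rho K (WX K) = mX K := by simp [rho, WX]
lemma rho_Y : rho K (WY K) = th K := by simp [rho, WY]

theorem weyl_induction {p : WeylAlgebra K → Prop} (h0 : ∀ c, p (algebraMap K _ c))
    (hX : p (WX K)) (hY : p (WY K)) (ha : ∀ a b, p a → p b → p (a + b))
    (hm : ∀ a b, p a → p b → p (a * b)) (a : WeylAlgebra K) : p a := by
  obtain ⟨a, rfl⟩ := RingQuot.mkAlgHom_surjective K (weylRel K) a
  induction a using FreeAlgebra.induction with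
  | grade0 r => simpa using h0 r
  | grade1 i => fin_cases i; exacts [hX, hY]
  | mul a b h1 h2 => simpa using hm _ _ h1 h2
  | add a b h1 h2 => simpa using ha _ _ h1 h2

noncomputable def op : K[X][X] →ₗ[K] WeylAlgebra K :=
  Polynomial.lsum (fun n => LinearMap.mulRight K (WY K ^ n) ∘ₗ (aeval (WX K)).toLinearMap)

lemma op_monomial (n : ℕ) (c : K[X]) : op K (monomial n c) = aeval (WX K) c * WY K ^ n := by
  simp [op, Polynomial.lsum, Polynomial.sum_monomial_index]

lemma Y_aeval (c : K[X]) : WY K * aeval (WX K) c =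
    aeval (WX K) c * WY K + aeval (WX K) (derivative c) := by
  induction c using Polynomial.induction_on with
  | C a => simp [Algebra.commutes]
  | add p q hp hq => simp only [map_add, mul_add, add_mul, hp, hq]; abel
  | monomial n a ih =>
    have e : (C a * X ^ (n + 1) : K[X]) = (C a * X ^ n) * X := by ring
    have e2 : derivative ((C a * X ^ n : K[X]) * X) = derivative (C a * X ^ n : K[X]) * X + C a * X ^ n := by
      rw [derivative_mul, derivative_X, mul_one]
    rw [e, e2]
    generalize (C a * X ^ n : K[X]) = q at ih ⊢
    rw [map_mul, map_add, map_mul, aeval_X, ← mul_assoc, ih, add_mul, mul_assoc, WYX]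
    noncomm_ring

lemma op_mX (g : K[X][X]) : op K (mX K g) = WX K * op K g := by
  induction g using Polynomial.induction_on' with
  | add p q hp hq => simp [hp, hq, mul_add]
  | monomial n c => simp [mX, op_monomial, C_mul_monomial, mul_assoc]

lemma op_th (g : K[X][X]) : op K (th K g) = WY K * op K g := by
  induction g using Polynomial.induction_on' with
  | add p q hp hq => simp [hp, hq, mul_add]
  | monomial n c =>
    simp [th, op_monomial, X_mul_monomial, dX_monomial, ← mul_assoc, Y_aeval, add_mul]
    rw [pow_succ', ← mul_assoc]

lemma op_rho (a : WeylAlgebra K) : ∀ g, op K (rho K a g) = a * op K g := by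
  induction a using weyl_induction with
  | h0 c =>
    intro g
    rw [AlgHom.commutes, Module.algebraMap_end_apply, map_smul, Algebra.smul_def]
  | hX => intro g; rw [rho_X, op_mX]
  | hY => intro g; rw [rho_Y, op_th]
  | ha a b h1 h2 => intro g; simp [h1, h2, add_mul]
  | hm a b h1 h2 => intro g; simp [h1, h2, mul_assoc]

noncomputable def sym : WeylAlgebra K →ₗ[K] K[X][X] :=
  (LinearMap.applyₗ (1 : K[X][X])) ∘ₗ (rho K).toLinearMap

lemma sym_apply (a) : sym K a = rho K a 1 := rfl

lemma op_sym (a) : op K (sym K a) = a := by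
  rw [sym_apply, op_rho]
  have : op K 1 = 1 := by
    have := op_monomial K 0 1
    simpa using this
  rw [this, mul_one]

lemma rho_aeval (c : K[X]) (g : K[X][X]) : rho K (aeval (WX K) c) g = C c * g := by
  induction c using Polynomial.induction_on with
  | C a => 
    simp [Module.algebraMap_end_apply]
    ext1 k
    simp [Polynomial.smul_eq_C_mul]
  | add p q hp hq => simp [hp, hq, add_mul]
  | monomial n a ih =>
    have e : (C a * X ^ (n + 1) : K[X]) = X * (C a * X ^ n) := by ring
    rw [e, map_mul, map_mul, Module.End.mul_apply, ih, aeval_X, rho_X]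
    simp [mX, mul_assoc]

lemma rho_op (f g : K[X][X]) (m : ℕ) (hf : f.natDegree ≤ m) :
    rho K (op K f) g = ∑ j ∈ Finset.range (m + 1), C (f.coeff j) * (th K ^ j) g := by
  conv_lhs => rw [f.as_sum_range' (m+1) (by omega)]
  simp only [map_sum, op_monomial, map_mul, map_pow, rho_Y, LinearMap.sum_apply,
    Module.End.mul_apply, rho_aeval]

lemma sym_mul (a b) (m : ℕ) (hf : (sym K a).natDegree ≤ m) :
    sym K (a * b) = ∑ j ∈ Finset.range (m + 1), C ((sym K a).coeff j) * (th K ^ j) (sym K b) := by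
  rw [← rho_op K _ _ m hf, op_sym]
  simp [sym_apply]

lemma coeff_th_zero (g : K[X][X]) : (th K g).coeff 0 = derivative (g.coeff 0) := by
  simp [th, coeff_dX]
lemma coeff_th_succ (g : K[X][X]) (k) :
    (th K g).coeff (k+1) = g.coeff k + derivative (g.coeff (k+1)) := by
  simp [th, coeff_dX]

lemma th_deg (g : K[X][X]) (n : ℕ) (hg : ∀ k, n < k → g.coeff k = 0) (j : ℕ) :
    ∀ k, n + j < k → ((th K ^ j) g).coeff k = 0 := by
  induction j with
  | zero => simpa using hg
  | succ j ih =>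
    intro k hk
    obtain ⟨k, rfl⟩ : ∃ l, k = l + 1 := ⟨k - 1, by omega⟩
    rw [pow_succ', Module.End.mul_apply, coeff_th_succ, ih _ (by omega), ih _ (by omega)]
    simp

lemma th_top (g : K[X][X]) (n : ℕ) (hg : ∀ k, n < k → g.coeff k = 0) (j : ℕ) :
    ((th K ^ j) g).coeff (n + j) = g.coeff n := by
  induction j with
  | zero => simp
  | succ j ih =>
    rw [pow_succ', Module.End.mul_apply, ← add_assoc, coeff_th_succ, ih,
      th_deg K g n hg j _ (by omega)]
    simp

lemma th_sub (g : K[X][X]) (n : ℕ) (hg : ∀ k, n < k → g.coeff k = 0) (j : ℕ) :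
    ∀ k, k + 1 = n + j → ((th K ^ j) g).coeff k = (X ^ j * g).coeff k
      + (j : K[X]) * derivative (g.coeff n) := by
  induction j with
  | zero => simp
  | succ j ih =>
    intro k hk
    have hk' : k = n + j := by omega
    rw [pow_succ', Module.End.mul_apply]
    have e : ((th K ^ j) g).coeff k = g.coeff n := by rw [hk', th_top K g n hg]
    rcases k with _ | k
    · obtain ⟨rfl, rfl⟩ : n = 0 ∧ j = 0 := by omega
      simp [coeff_th_zero]
    · rw [coeff_th_succ, e, ih k (by omega), pow_succ', mul_assoc X, coeff_X_mul]
      push_cast; ring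

lemma sym_deg (a b) (m n : ℕ) (ha : (sym K a).natDegree ≤ m) (hb : (sym K b).natDegree ≤ n) :
    (sym K (a * b)).natDegree ≤ m + n := by
  have hb' : ∀ k, n < k → (sym K b).coeff k = 0 := fun k hk => coeff_eq_zero_of_natDegree_lt (by omega)
  rw [natDegree_le_iff_coeff_eq_zero]
  intro k hk
  rw [sym_mul K a b m ha, finsetSum_coeff]
  refine Finset.sum_eq_zero fun j hj => ?_
  rw [coeff_C_mul, th_deg K _ n hb' j k (by simp at hj; omega), mul_zero]

lemma sym_mul0 (a b) (m n : ℕ) (ha : (sym K a).natDegree ≤ m) (hb : (sym K b).natDegree ≤ n) :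
    (sym K (a * b)).coeff (m + n) = (sym K a).coeff m * (sym K b).coeff n := by
  have hb' : ∀ k, n < k → (sym K b).coeff k = 0 := fun k hk => coeff_eq_zero_of_natDegree_lt (by omega)
  rw [sym_mul K a b m ha, finsetSum_coeff, Finset.sum_range_succ, Finset.sum_eq_zero, zero_add,
    coeff_C_mul, add_comm m n, th_top K _ n hb']
  intro j hj
  rw [coeff_C_mul, th_deg K _ n hb' j _ (by simp at hj; omega), mul_zero]

lemma sym_mul1 (a b) (m n k : ℕ) (ha : (sym K a).natDegree ≤ m) (hb : (sym K b).natDegree ≤ n)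
    (hk : k + 1 = m + n) :
    (sym K (a * b)).coeff k = (sym K a * sym K b).coeff k
      + (m : K[X]) * (sym K a).coeff m * derivative ((sym K b).coeff n) := by
  have hb' : ∀ k, n < k → (sym K b).coeff k = 0 := fun k hk => coeff_eq_zero_of_natDegree_lt (by omega)
  have e : (sym K a * sym K b).coeff k =
      ∑ j ∈ Finset.range (m + 1), (sym K a).coeff j * (X ^ j * sym K b).coeff k := by
    conv_lhs => rw [(sym K a).as_sum_range' (m+1) (by omega)]
    rw [Finset.sum_mul, finsetSum_coeff]
    refine Finset.sum_congr rfl fun j _ => ?_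
    rw [← C_mul_X_pow_eq_monomial, mul_assoc, coeff_C_mul]
  rw [sym_mul K a b m ha, finsetSum_coeff, e, Finset.sum_range_succ, Finset.sum_range_succ,
    coeff_C_mul, th_sub K _ n hb' m k (by omega)]
  have : ∑ x ∈ Finset.range m, (C ((sym K a).coeff x) * (th K ^ x) (sym K b)).coeff k
      = ∑ x ∈ Finset.range m, (sym K a).coeff x * (X ^ x * sym K b).coeff k := by
    refine Finset.sum_congr rfl fun j hj => ?_
    rw [coeff_C_mul]
    congr 1
    simp only [Finset.mem_range] at hj
    rcases Nat.lt_or_ge (j + 1) m with h | h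
    · rw [th_deg K _ n hb' j k (by omega), coeff_X_pow_mul', if_pos (by omega), hb' _ (by omega)]
    · obtain rfl : k = n + j := by omega
      rw [th_top K _ n hb', coeff_X_pow_mul]
  rw [this]; ring

noncomputable def gen : Submodule K (WeylAlgebra K) := Submodule.span K {1, WX K, WY K}

open scoped Classical in
noncomputable def mons (n : ℕ) : Finset (WeylAlgebra K) :=
  (Finset.range (n + 1) ×ˢ Finset.range (n + 1)).image (fun p => WX K ^ p.1 * WY K ^ p.2)

lemma mons_card (n) : (mons K n).card ≤ (n + 1) ^ 2 := by
  classical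
  unfold mons
  refine Finset.card_image_le.trans ?_
  simp [sq]

lemma mem_mons (n i j : ℕ) (hi : i ≤ n) (hj : j ≤ n) : WX K ^ i * WY K ^ j ∈ mons K n := by
  classical
  exact Finset.mem_image.2 ⟨(i, j), by simp; omega, rfl⟩

lemma Y_Xpow (i : ℕ) : WY K * WX K ^ i = WX K ^ i * WY K + (i : K) • WX K ^ (i - 1) := by
  have := Y_aeval K (X ^ i)
  rw [derivative_X_pow] at this
  simpa [Algebra.smul_def] using this

lemma gen_pow_le (n : ℕ) : gen K ^ n ≤ Submodule.span K (mons K n : Set (WeylAlgebra K)) := by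
  induction n with
  | zero =>
    rw [pow_zero, Submodule.one_le]
    exact Submodule.subset_span (by simpa using mem_mons K 0 0 0 le_rfl le_rfl)
  | succ n ih =>
    rw [pow_succ']
    refine (mul_le_mul_right ih _).trans ?_
    rw [gen, Submodule.span_mul_span, Submodule.span_le]
    rintro _ ⟨u, hu, v, hv, rfl⟩
    classical
    obtain ⟨⟨i, j⟩, hij, rfl⟩ := Finset.mem_image.1 hv
    simp only [Finset.mem_product, Finset.mem_range] at hij
    rcases hu with rfl | rfl | rfl
    · exact Submodule.subset_span (by simpa using mem_mons K (n+1) i j (by omega) (by omega))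
    · refine Submodule.subset_span ?_
      have := mem_mons K (n+1) (i+1) j (by omega) (by omega)
      simpa [pow_succ', mul_assoc] using this
    · simp only [← mul_assoc, Y_Xpow, add_mul]
      refine Submodule.add_mem _ (Submodule.subset_span ?_) ?_
      · have := mem_mons K (n+1) i (j+1) (by omega) (by omega)
        simpa [pow_succ', mul_assoc] using this
      · rw [smul_mul_assoc]
        refine Submodule.smul_mem _ _ (Submodule.subset_span ?_)
        exact mem_mons K (n+1) (i-1) j (by omega) (by omega)

lemma one_le_gen : 1 ≤ gen K := Submodule.one_le.2 (Submodule.subset_span (by simp))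

noncomputable def data : SymData K (WeylAlgebra K) where
  s := sym K
  inj := Function.LeftInverse.injective (op_sym K)
  one := by simp [sym_apply]
  deg_le := sym_deg K
  mul0 := sym_mul0 K
  mul1 := sym_mul1 K
  G n := gen K ^ n
  Gfin n := ⟨mons K n, mons_card K n, gen_pow_le K n⟩
  Gmono := pow_right_monotone (one_le_gen K)
  Gone n := by
    have : (1 : Submodule K (WeylAlgebra K)) ≤ gen K ^ n := one_le_pow_of_one_le' (one_le_gen K) n
    exact Submodule.one_le.1 this
  Gmul m n a b ha hb := by
    rw [pow_add]; exact Submodule.mul_mem_mul ha hb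
  Gex a := by
    have hmono : Monotone (fun n => gen K ^ n) := pow_right_monotone (one_le_gen K)
    induction a using weyl_induction with
    | h0 c => exact ⟨0, by simp [Submodule.mem_one]⟩
    | hX => exact ⟨1, by rw [pow_one]; exact Submodule.subset_span (by simp)⟩
    | hY => exact ⟨1, by rw [pow_one]; exact Submodule.subset_span (by simp)⟩
    | ha a b h1 h2 =>
      obtain ⟨m, hm⟩ := h1
      obtain ⟨n, hn⟩ := h2
      exact ⟨max m n, Submodule.add_mem _ (hmono (le_max_left m n) hm) (hmono (le_max_right m n) hn)⟩
    | hm a b h1 h2 =>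
      obtain ⟨m, hm⟩ := h1
      obtain ⟨n, hn⟩ := h2
      exact ⟨m + n, by rw [pow_add]; exact Submodule.mul_mem_mul hm hn⟩
end
end WeylSym


namespace SymData
open Polynomial

lemma wronsk {K : Type*} [Field K] [CharZero K] {a b : K[X]} (hb : b ≠ 0)
    (h : derivative a * b = derivative b * a) : ∃ c : K, a = C c * b := by
  have key : ∀ a : K[X], a ≠ 0 → derivative a * b = derivative b * a →
      a.natDegree = b.natDegree := by
    intro a ha h
    have h2 : (X * derivative a) * b = (X * derivative b) * a := by
      rw [mul_assoc, h, mul_assoc]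
    have ht : ∀ q : K[X], (X * derivative q).natDegree ≤ q.natDegree ∧
        (X * derivative q).coeff q.natDegree = q.natDegree * q.leadingCoeff := by
      intro q
      constructor
      · rw [natDegree_le_iff_coeff_eq_zero]
        intro k hk
        obtain ⟨k, rfl⟩ : ∃ l, k = l + 1 := ⟨k - 1, by omega⟩
        rw [coeff_X_mul, coeff_derivative, coeff_eq_zero_of_natDegree_lt (by omega), zero_mul]
      · rcases hq : q.natDegree with _ | n
        · simp
        · rw [coeff_X_mul, coeff_derivative, leadingCoeff, hq]; push_cast; ring
    have h3 := congrArg (fun q => q.coeff (a.natDegree + b.natDegree)) h2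
    rw [coeff_mul_add_eq_of_natDegree_le (ht a).1 le_rfl, add_comm a.natDegree,
      coeff_mul_add_eq_of_natDegree_le (ht b).1 le_rfl, (ht a).2, (ht b).2] at h3
    have hla : a.leadingCoeff ≠ 0 := leadingCoeff_ne_zero.2 ha
    have hlb : b.leadingCoeff ≠ 0 := leadingCoeff_ne_zero.2 hb
    have : ((a.natDegree : K) - b.natDegree) * (a.leadingCoeff * b.leadingCoeff) = 0 := by
      simp only [leadingCoeff] at h3 ⊢
      linear_combination h3
    have h4 := (mul_eq_zero.1 this).resolve_right (mul_ne_zero hla hlb)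
    exact_mod_cast sub_eq_zero.1 h4
  by_cases ha : a = 0
  · exact ⟨0, by simp [ha]⟩
  have hd := key a ha h
  refine ⟨a.leadingCoeff / b.leadingCoeff, ?_⟩
  set c := a.leadingCoeff / b.leadingCoeff with hc
  have hlb : b.leadingCoeff ≠ 0 := leadingCoeff_ne_zero.2 hb
  by_contra hne
  have hr : a - C c * b ≠ 0 := sub_ne_zero.2 hne
  have h5 := key _ hr (by
    simp only [derivative_sub, derivative_mul, derivative_C]
    linear_combination h)
  have h6 : (a - C c * b).coeff b.natDegree = 0 := by
    rw [coeff_sub, coeff_C_mul, ← hd]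
    conv_lhs => rw [hd]
    rw [← hd]
    have e1 : a.coeff a.natDegree = a.leadingCoeff := rfl
    have e2 : b.coeff a.natDegree = b.leadingCoeff := by rw [hd]; rfl
    rw [e1, e2, hc, div_mul_cancel₀ _ hlb, sub_self]
  rw [← h5] at h6
  exact hr (leadingCoeff_eq_zero.1 h6)

set_option linter.unusedSectionVars false
set_option linter.style.haveILetI false
variable {K A : Type*} [Field K] [CharZero K] [Ring A] [Algebra K A] (D : SymData K A)

noncomputable def deg (a : A) : ℕ := (D.s a).natDegree
noncomputable def lc (a : A) : K[X] := (D.s a).coeff (D.deg a)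

lemma s_ne {a : A} (ha : a ≠ 0) : D.s a ≠ 0 := fun h => ha (D.inj (by simpa using h))

lemma lc_ne {a : A} (ha : a ≠ 0) : D.lc a ≠ 0 := leadingCoeff_ne_zero.2 (D.s_ne ha)

lemma dom (D : SymData K A) {a b : A} (ha : a ≠ 0) (hb : b ≠ 0) : a * b ≠ 0 := by
  intro h
  have := D.mul0 a b _ _ le_rfl le_rfl
  rw [h, map_zero, coeff_zero] at this
  exact mul_ne_zero (D.lc_ne ha) (D.lc_ne hb) this.symm

lemma isDomain (D : SymData K A) : IsDomain A := by
  haveI : Nontrivial A := ⟨⟨1, 0, fun h => by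
    have := D.one
    rw [h, map_zero] at this
    exact zero_ne_one this⟩⟩
  haveI : NoZeroDivisors A := ⟨fun {a b} h => by
    by_contra hc
    push Not at hc
    exact D.dom hc.1 hc.2 h⟩
  exact NoZeroDivisors.to_isDomain A

lemma deg_mul {a b : A} (ha : a ≠ 0) (hb : b ≠ 0) : D.deg (a * b) = D.deg a + D.deg b := by
  refine le_antisymm (D.deg_le _ _ _ _ le_rfl le_rfl) (le_natDegree_of_ne_zero ?_)
  rw [D.mul0 a b (D.deg a) (D.deg b) le_rfl le_rfl]
  exact mul_ne_zero (D.lc_ne ha) (D.lc_ne hb)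

lemma lc_mul {a b : A} (ha : a ≠ 0) (hb : b ≠ 0) : D.lc (a * b) = D.lc a * D.lc b := by
  rw [lc, D.deg_mul ha hb, D.mul0 a b (D.deg a) (D.deg b) le_rfl le_rfl]; rfl

lemma deg_one : D.deg 1 = 0 := by simp [deg, D.one]

lemma deg_pow {a : A} (ha : a ≠ 0) (n : ℕ) : D.deg (a ^ n) = n * D.deg a := by
  haveI := D.isDomain
  induction n with
  | zero => simp [deg_one]
  | succ n ih => rw [pow_succ, D.deg_mul (pow_ne_zero _ ha) ha, ih]; ring

lemma s_alg (c : K) : D.s (algebraMap K A c) = C (C c) := by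
  rw [Algebra.algebraMap_eq_smul_one, map_smul, D.one]
  ext1 k
  rw [coeff_smul, coeff_C, coeff_one]
  split_ifs <;> simp [Polynomial.smul_eq_C_mul]

lemma smul_ne {c : K} {a : A} (hc : c ≠ 0) (ha : a ≠ 0) : c • a ≠ 0 := smul_ne_zero hc ha

lemma deg_smul_le (c : K) (a : A) : D.deg (c • a) ≤ D.deg a := by
  rw [deg, map_smul]; exact natDegree_smul_le _ _

lemma deg_sub_le (a b : A) : D.deg (a - b) ≤ max (D.deg a) (D.deg b) := by
  rw [deg, map_sub]; exact natDegree_sub_le _ _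

lemma comm_coeff (a b : A) (m n k : ℕ) (ha : D.deg a ≤ m) (hb : D.deg b ≤ n) (hk : k + 1 = m + n) :
    (D.s (a * b - b * a)).coeff k = (m : K[X]) * (D.s a).coeff m * derivative ((D.s b).coeff n)
      - (n : K[X]) * (D.s b).coeff n * derivative ((D.s a).coeff m) := by
  rw [map_sub, coeff_sub, D.mul1 a b m n k ha hb hk, D.mul1 b a n m k hb ha (by omega),
    mul_comm (D.s b)]
  ring

lemma comm_deg (a b : A) (hne : a * b - b * a ≠ 0) :
    D.deg (a * b - b * a) + 1 ≤ D.deg a + D.deg b := by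
  by_contra hlt
  have h1 : D.deg (a * b - b * a) ≤ D.deg a + D.deg b := by
    refine (D.deg_sub_le _ _).trans (max_le (D.deg_le _ _ _ _ le_rfl le_rfl) ?_)
    rw [add_comm]; exact D.deg_le _ _ _ _ le_rfl le_rfl
  have h2 : D.deg (a * b - b * a) = D.deg a + D.deg b := by omega
  apply D.lc_ne hne
  rw [lc, h2, map_sub, coeff_sub, D.mul0 a b (D.deg a) (D.deg b) le_rfl le_rfl, add_comm,
    D.mul0 b a (D.deg b) (D.deg a) le_rfl le_rfl, mul_comm, sub_self]

/-- eigenvectors of `ad h` -/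
def Eig (h : A) (l : K) (b : A) : Prop := h * b - b * h = l • b

lemma Eig.mul {h : A} {l m : K} {a b : A} (ha : Eig h l a) (hb : Eig h m b) :
    Eig h (l + m) (a * b) := by
  unfold Eig at *
  have : h * (a * b) - a * b * h = (h * a - a * h) * b + a * (h * b - b * h) := by noncomm_ring
  rw [this, ha, hb, add_smul, smul_mul_assoc, mul_smul_comm]

lemma Eig.one (h : A) : Eig h (0 : K) (1 : A) := by simp [Eig]

lemma Eig.self (h : A) : Eig h (0 : K) h := by simp [Eig]

lemma Eig.add {h : A} {l : K} {a b : A} (ha : Eig h l a) (hb : Eig h l b) : Eig h l (a + b) := by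
  unfold Eig at *
  rw [smul_add, ← ha, ← hb]; noncomm_ring

lemma Eig.smul {h : A} {l : K} {a : A} (c : K) (ha : Eig h l a) : Eig h l (c • a) := by
  unfold Eig at *
  rw [smul_comm l c, ← ha, smul_sub, mul_smul_comm, smul_mul_assoc]

lemma Eig.sub {h : A} {l : K} {a b : A} (ha : Eig h l a) (hb : Eig h l b) : Eig h l (a - b) := by
  have := ha.add (hb.smul (-1))
  simpa [sub_eq_add_neg] using this

lemma Eig.pow {h : A} {l : K} {a : A} (ha : Eig h l a) (n : ℕ) : Eig h (n * l) (a ^ n) := by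
  induction n with
  | zero => simpa using Eig.one h
  | succ n ih =>
    have := ih.mul ha
    rw [pow_succ]; convert this using 1; push_cast; ring

lemma eig0 {h b : A} : Eig h (0 : K) b ↔ h * b = b * h := by
  simp [Eig, sub_eq_zero]

lemma OD {h a b : A} {l : K} (hd : 1 ≤ D.deg h) (ha : Eig h l a) (hb : Eig h l b)
    (hb0 : b ≠ 0) (hab : D.deg a = D.deg b) :
    ∃ c : K, a - c • b = 0 ∨ D.deg (a - c • b) < D.deg a := by
  have hh0 : h ≠ 0 := by rintro rfl; simp [deg] at hd
  set n := D.deg b with hn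
  set d := D.deg h with hdd
  have hE : ∃ μ : K[X], ∀ e : A, Eig h l e → D.deg e ≤ n →
      (d : K[X]) * D.lc h * derivative ((D.s e).coeff n)
       - (n : K[X]) * (D.s e).coeff n * derivative (D.lc h) = μ * (D.s e).coeff n := by
    refine ⟨if d = 1 then C l else 0, fun e he hen => ?_⟩
    have h1 := D.comm_coeff h e d n (d + n - 1) le_rfl hen (by omega)
    rw [he] at h1
    rw [lc, ← hdd, ← h1, map_smul, coeff_smul, smul_eq_C_mul]
    split_ifs with hd1
    · rw [hd1]; congr 2; omega
    · rw [coeff_eq_zero_of_natDegree_lt (p := D.s e) (by unfold deg at *; omega)]; simp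
  obtain ⟨μ, hμ⟩ := hE
  have e1 := hμ a ha hab.le
  have e2 := hμ b hb le_rfl
  have hlb : (D.s b).coeff n ≠ 0 := D.lc_ne hb0
  have hlh : D.lc h ≠ 0 := D.lc_ne hh0
  have hdK : (d : K[X]) ≠ 0 := by exact_mod_cast (by omega : d ≠ 0)
  obtain ⟨c, hc⟩ := wronsk (a := (D.s a).coeff n) hlb (by
    apply mul_left_cancel₀ (mul_ne_zero hdK hlh)
    linear_combination (D.s b).coeff n * e1 - (D.s a).coeff n * e2)
  refine ⟨c, ?_⟩
  by_cases hz : a - c • b = 0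
  · exact Or.inl hz
  right
  have hle : D.deg (a - c • b) ≤ n :=
    (D.deg_sub_le _ _).trans (max_le hab.le (D.deg_smul_le _ _))
  rw [hab]
  refine lt_of_le_of_ne hle fun heq => ?_
  apply D.lc_ne hz
  rw [lc, heq, map_sub, map_smul, coeff_sub, coeff_smul, hc, smul_eq_C_mul, sub_self]

lemma aeval_deg_aux (h : A) (n : ℕ) : ∀ p : K[X], p.natDegree ≤ n →
    (D.deg (aeval h p) ≤ n * D.deg h) ∧
    (1 ≤ D.deg h → (D.s (aeval h p)).coeff (n * D.deg h) = C (p.coeff n) * (D.lc h) ^ n) := by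
  induction n with
  | zero =>
    intro p hp
    rw [eq_C_of_natDegree_le_zero hp, aeval_C, deg, s_alg]
    simp
  | succ n ih =>
    intro p hp
    have hp2 : p.divX.natDegree ≤ n := by rw [natDegree_divX_eq_natDegree_tsub_one]; omega
    obtain ⟨i1, i2⟩ := ih _ hp2
    have e : D.s (aeval h p) = D.s (aeval h p.divX * h) + C (C (p.coeff 0)) := by
      conv_lhs => rw [← divX_mul_X_add p]
      rw [map_add, map_mul, aeval_X, aeval_C, map_add, s_alg]
    constructor
    · rw [deg, e]
      refine natDegree_add_le_of_degree_le ?_ (by simp)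
      rw [add_mul, one_mul]
      exact D.deg_le _ _ _ _ i1 le_rfl
    · intro hd
      rw [e, coeff_add, coeff_C, if_neg (by
        have : 1 ≤ (n+1) * D.deg h := Nat.mul_pos (by omega) hd
        omega), add_mul, one_mul, D.mul0 _ _ _ (D.deg h) i1 le_rfl, i2 hd, coeff_divX, pow_succ, add_zero,
        mul_assoc]
      rfl

lemma aeval_deg {h : A} (hd : 1 ≤ D.deg h) {p : K[X]} (hp : p ≠ 0) :
    aeval h p ≠ 0 ∧ D.deg (aeval h p) = p.natDegree * D.deg h := by
  have hh0 : h ≠ 0 := by rintro rfl; simp [deg] at hd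
  obtain ⟨h1, h2⟩ := D.aeval_deg_aux h p.natDegree p le_rfl
  have h3 : (D.s (aeval h p)).coeff (p.natDegree * D.deg h) ≠ 0 := by
    rw [h2 hd]
    refine mul_ne_zero ?_ (pow_ne_zero _ (D.lc_ne hh0))
    rw [Ne, C_eq_zero]; exact leadingCoeff_ne_zero.2 hp
  constructor
  · intro h0; rw [h0] at h3; simp at h3
  · exact le_antisymm h1 (le_natDegree_of_ne_zero h3)

lemma aeval_inj {h : A} (hd : 1 ≤ D.deg h) {p q : K[X]} (he : aeval h p = aeval h q) : p = q := by
  by_contra hne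
  exact (D.aeval_deg hd (sub_ne_zero.2 hne)).1 (by rw [map_sub, he, sub_self])

lemma aeval_comm {h v : A} (hv : Commute h v) (p : K[X]) : Commute (aeval h p) v := by
  induction p using Polynomial.induction_on' with
  | add p q hp hq => rw [map_add]; exact hp.add_left hq
  | monomial n c =>
    rw [aeval_monomial]
    exact (Algebra.commute_algebraMap_left c v).mul_left (hv.pow_left n)

theorem comm_cent {h : A} (hd : 1 ≤ D.deg h) {c c' : A} (hc : h * c = c * h)
    (hc' : h * c' = c' * h) : c * c' = c' * c := by
  classical
  haveI := D.isDomain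
  have hh0 : h ≠ 0 := by rintro rfl; simp [deg] at hd
  set d := D.deg h with hdd
  let H : AddSubgroup ℤ :=
    { carrier := {z | ∃ c : A, c ≠ 0 ∧ Eig h (0 : K) c ∧ (d : ℤ) ∣ z - D.deg c}
      zero_mem' := ⟨1, one_ne_zero, Eig.one h, by simp [deg_one]⟩
      add_mem' := by
        rintro a b ⟨c, h1, h2, h3⟩ ⟨c', h1', h2', h3'⟩
        refine ⟨c * c', mul_ne_zero h1 h1', by simpa using h2.mul h2', ?_⟩
        rw [D.deg_mul h1 h1']
        have := dvd_add h3 h3'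
        push_cast
        have e : a + b - (D.deg c + D.deg c' : ℤ) = a - D.deg c + (b - D.deg c') := by ring
        rw [e]; exact this
      neg_mem' := by
        rintro a ⟨c, h1, h2, h3⟩
        refine ⟨c ^ (d - 1), pow_ne_zero _ h1, by simpa using h2.pow (d - 1), ?_⟩
        rw [D.deg_pow h1]
        have : (d : ℤ) ∣ -(a - D.deg c) - d * D.deg c := dvd_sub (dvd_neg.2 h3) (dvd_mul_right _ _)
        convert this using 1
        push_cast [Nat.cast_sub hd]; ring }
  obtain ⟨g, hg⟩ := Int.subgroup_cyclic H
  obtain ⟨u, hu0, hu, hud⟩ : g ∈ H := by rw [hg]; exact AddSubgroup.subset_closure rfl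
  have hdeg : ∀ c : A, c ≠ 0 → Eig h (0 : K) c → ∃ i : ℕ, i < d ∧
      (d : ℤ) ∣ D.deg c - (i : ℤ) * D.deg u := by
    intro c h1 h2
    have hm : (D.deg c : ℤ) ∈ H := ⟨c, h1, h2, by simp⟩
    rw [hg, AddSubgroup.mem_closure_singleton] at hm
    obtain ⟨n, hn⟩ := hm
    have hdpos : (0 : ℤ) < d := by omega
    refine ⟨(n % d).toNat, ?_, ?_⟩
    · have := Int.emod_lt_of_pos n hdpos
      have := Int.emod_nonneg n hdpos.ne'
      omega
    · rw [Int.toNat_of_nonneg (Int.emod_nonneg n hdpos.ne'), ← hn, smul_eq_mul]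
      have e : n * g - n % d * D.deg u = n * (g - D.deg u) + (n - n % d) * D.deg u := by ring
      rw [e]
      exact dvd_add (Dvd.dvd.mul_left hud _)
        (Dvd.dvd.mul_right (Int.dvd_self_sub_emod) _)
  let R := Algebra.adjoin K ({h, u} : Set A)
  let mk := (Subalgebra.toSubmodule R).mkQ
  let N0 := d * D.deg u
  let e : ℕ → A := fun n =>
    if hx : ∃ c : A, c ≠ 0 ∧ Eig h (0 : K) c ∧ D.deg c = n then hx.choose else 0
  let T : Submodule K (A ⧸ Subalgebra.toSubmodule R) :=
    Submodule.span K (((Finset.range N0).image (fun n => mk (e n)) : Finset _) : Set _)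
  have hT : ∀ n : ℕ, ∀ c : A, D.deg c = n → Eig h (0 : K) c → mk c ∈ T := by
    intro n
    induction n using Nat.strong_induction_on with
    | _ n ih =>
    intro c hcn hc
    by_cases hc0 : c = 0
    · rw [hc0, map_zero]; exact T.zero_mem
    have hex : ∃ r : A, r ≠ 0 ∧ Eig h (0 : K) r ∧ D.deg c = D.deg r ∧ mk r ∈ T := by
      by_cases hlt : n < N0
      · have hx : ∃ c : A, c ≠ 0 ∧ Eig h (0 : K) c ∧ D.deg c = n := ⟨c, hc0, hc, hcn⟩
        have he : e n = hx.choose := dif_pos hx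
        refine ⟨e n, ?_⟩
        obtain ⟨h1, h2, h3⟩ := hx.choose_spec
        rw [he]
        refine ⟨h1, h2, by omega, ?_⟩
        rw [← he]
        exact Submodule.subset_span (Finset.mem_coe.2 (Finset.mem_image_of_mem _ (by simpa using hlt)))
      · obtain ⟨i, hi, hid⟩ := hdeg c hc0 hc
        obtain ⟨j, hj⟩ := hid
        have hle : i * D.deg u ≤ D.deg c := by
          have : i * D.deg u ≤ d * D.deg u := Nat.mul_le_mul_right _ hi.le
          omega
        have hj0 : 0 ≤ j := by
          have : (0 : ℤ) ≤ d * j := by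
            rw [← hj]; have : ((i * D.deg u : ℕ) : ℤ) ≤ D.deg c := by exact_mod_cast hle
            push_cast at this; omega
          exact nonneg_of_mul_nonneg_right this (by omega)
        lift j to ℕ using hj0
        refine ⟨h ^ j * u ^ i, mul_ne_zero (pow_ne_zero _ hh0) (pow_ne_zero _ hu0),
          by simpa using ((Eig.self h).pow j).mul (hu.pow i), ?_, ?_⟩
        · rw [D.deg_mul (pow_ne_zero _ hh0) (pow_ne_zero _ hu0), D.deg_pow hh0, D.deg_pow hu0]
          zify
          rw [← hdd]
          linear_combination hj
        · have : mk (h ^ j * u ^ i) = 0 := by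
            rw [Submodule.mkQ_apply, Submodule.Quotient.mk_eq_zero, Subalgebra.mem_toSubmodule]
            exact mul_mem (pow_mem (Algebra.subset_adjoin (by simp)) _)
              (pow_mem (Algebra.subset_adjoin (by simp)) _)
          rw [this]; exact T.zero_mem
    obtain ⟨r, hr0, hr, hdr, hrT⟩ := hex
    obtain ⟨κ, hκ⟩ := D.OD hd hc hr hr0 hdr
    have h1 : mk (c - κ • r) ∈ T := by
      rcases hκ with h0 | hlt
      · rw [h0, map_zero]; exact T.zero_mem
      · exact ih _ (hcn ▸ hlt) _ rfl (hc.sub (hr.smul κ))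
    have : mk c = mk (c - κ • r) + κ • mk r := by rw [map_sub, map_smul]; abel
    rw [this]
    exact T.add_mem h1 (T.smul_mem _ hrT)
  have hcl : ∀ c : A, h * c = c * h → ∃ p : K[X], p ≠ 0 ∧ aeval h p * c ∈ R := by
    intro c hc
    let φ : K[X] →ₗ[K] A ⧸ Subalgebra.toSubmodule R :=
      mk ∘ₗ LinearMap.mulRight K c ∘ₗ (aeval h).toLinearMap
    have hφ : ∀ p, φ p ∈ T := by
      intro p
      refine hT _ _ rfl ?_
      have : Commute h (aeval h p * c) :=
        Commute.mul_right (aeval_comm (Commute.refl h) p).symm hc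
      exact eig0.2 this.eq
    haveI : FiniteDimensional K T := FiniteDimensional.span_finset K _
    by_contra hno
    push Not at hno
    have hinj : Function.Injective (φ.codRestrict T hφ) := by
      rw [← LinearMap.ker_eq_bot, LinearMap.ker_codRestrict, LinearMap.ker_eq_bot']
      intro p hp
      by_contra hp0
      refine hno p hp0 ?_
      have : mk (aeval h p * c) = 0 := hp
      rwa [Submodule.mkQ_apply, Submodule.Quotient.mk_eq_zero, Subalgebra.mem_toSubmodule] at this
    have := Module.Finite.of_injective _ hinj
    exact Polynomial.not_finite this
  obtain ⟨p, hp0, hp⟩ := hcl c hc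
  obtain ⟨q, hq0, hq⟩ := hcl c' hc'
  have hR : ∀ a ∈ R, ∀ b ∈ R, a * b = b * a := by
    have hhu : h * u = u * h := eig0.1 hu
    have := Algebra.isMulCommutative_adjoin K (s := ({h, u} : Set A)) (by
      rintro a (rfl | rfl) b (rfl | rfl)
      exacts [rfl, hhu, hhu.symm, rfl])
    intro a ha b hb
    exact setLike_mul_comm ha hb
  have h1 := hR _ hp _ hq
  have cp : ∀ r : K[X], ∀ v, h * v = v * h → aeval h r * v = v * aeval h r := by
    intro r v hv
    exact (aeval_comm (show Commute h v from hv) r).eq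
  have hpq : aeval h p * aeval h q = aeval h q * aeval h p := by rw [← map_mul, mul_comm, map_mul]
  have h2 : (aeval h p * aeval h q) * (c * c' - c' * c) = 0 := by
    have e1 : aeval h p * aeval h q * (c * c') = aeval h p * c * (aeval h q * c') := by
      rw [mul_assoc, ← mul_assoc _ c c', cp q c hc]; noncomm_ring
    have e2 : aeval h p * aeval h q * (c' * c) = aeval h q * c' * (aeval h p * c) := by
      rw [hpq, mul_assoc, ← mul_assoc _ c' c, cp p c' hc']; noncomm_ring
    rw [mul_sub, e1, e2, h1, sub_self]
  rcases mul_eq_zero.1 h2 with h3 | h3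
  · exact absurd h3 (mul_ne_zero (D.aeval_deg hd hp0).1 (D.aeval_deg hd hq0).1)
  · exact sub_eq_zero.1 h3

end SymData


namespace SymData
open Polynomial

/-- almost divisibility -/
def Good {R : Type*} [CommRing R] (g u : R) : Prop := ∃ q : R, q ≠ 0 ∧ ∀ j : ℕ, g ^ j ∣ q * u ^ j

lemma Good.add {R : Type*} [CommRing R] [IsDomain R] {g u v : R} (hu : Good g u) (hv : Good g v) :
    Good g (u + v) := by
  obtain ⟨q, hq, h1⟩ := hu
  obtain ⟨r, hr, h2⟩ := hv
  refine ⟨q * r, mul_ne_zero hq hr, fun j => ?_⟩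
  rw [add_pow, Finset.mul_sum]
  refine Finset.dvd_sum fun i hi => ?_
  have hi' : i + (j - i) = j := by simp at hi; omega
  have : q * r * (u ^ i * v ^ (j - i) * (j.choose i : R)) =
    (q * u ^ i) * (r * v ^ (j - i)) * (j.choose i : R) := by ring
  rw [this]
  refine Dvd.dvd.mul_right ?_ _
  conv_lhs => rw [← hi', pow_add]
  exact mul_dvd_mul (h1 _) (h2 _)

lemma Good.neg {R : Type*} [CommRing R] {g u : R} (hu : Good g u) : Good g (-u) := by
  obtain ⟨q, hq, h1⟩ := hu
  refine ⟨q, hq, fun j => ?_⟩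
  rw [neg_pow, mul_left_comm]
  exact Dvd.dvd.mul_left (h1 j) _

lemma Good.zero {R : Type*} [CommRing R] [Nontrivial R] {g : R} : Good g 0 := by
  refine ⟨1, one_ne_zero, fun j => ?_⟩
  rcases j with _ | j <;> simp

set_option linter.unusedSectionVars false
set_option linter.style.haveILetI false
variable {K A : Type*} [Field K] [CharZero K] [Ring A] [Algebra K A] (D : SymData K A)

noncomputable def M (a : A) : ℕ := D.deg a + (D.lc a).natDegree

lemma M_mul {a b : A} (ha : a ≠ 0) (hb : b ≠ 0) : D.M (a * b) = D.M a + D.M b := by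
  rw [M, M, M, D.deg_mul ha hb, D.lc_mul ha hb, natDegree_mul (D.lc_ne ha) (D.lc_ne hb)]; ring

lemma M_zero {a : A} (h : D.M a = 0) : ∃ c : K, a = algebraMap K A c := by
  obtain ⟨h1, h2⟩ : D.deg a = 0 ∧ (D.lc a).natDegree = 0 := by unfold M at h; omega
  refine ⟨(D.lc a).coeff 0, D.inj ?_⟩
  rw [s_alg, ← eq_C_of_natDegree_eq_zero h2, lc, h1]
  exact eq_C_of_natDegree_eq_zero h1

lemma M_alg (c : K) : D.M (algebraMap K A c) = 0 := by
  simp [M, lc, deg, s_alg]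

lemma M_smul {c : K} {a : A} (hc : c ≠ 0) (ha : a ≠ 0) : D.M (c • a) = D.M a := by
  haveI := D.isDomain
  rw [Algebra.smul_def, D.M_mul (by simpa using hc) ha, M_alg, zero_add]

lemma semi {z h h' : A} (hz : z * h = h' * z) (p : K[X]) : z * aeval h p = aeval h' p * z := by
  have hp : ∀ n : ℕ, z * h ^ n = h' ^ n * z := fun n =>
    (show SemiconjBy z h h' from hz).pow_right n
  induction p using Polynomial.induction_on' with
  | add p q hp hq => rw [map_add, map_add, mul_add, add_mul, hp, hq]
  | monomial n c =>
    rw [aeval_monomial, aeval_monomial, ← mul_assoc, ← Algebra.commutes, mul_assoc, hp, mul_assoc]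

noncomputable def adx (x : A) : A →ₗ[K] A := LinearMap.mulLeft K x - LinearMap.mulRight K x

lemma adx_apply (x b : A) : adx (K := K) x b = x * b - b * x := by simp [adx]

section W
variable {x y : A} (hxy : y * x - x * y = 1)

lemma xy_eq (hxy : y * x - x * y = 1) : x * y = y * x - 1 := by rw [← hxy]; abel

lemma eig_x (hxy : y * x - x * y = 1) : Eig (y * x) (1 : K) x := by
  have : y * x * x - x * (y * x) = (y * x - x * y) * x := by noncomm_ring
  rw [Eig, this, hxy]; simp

lemma eig_y (hxy : y * x - x * y = 1) : Eig (y * x) (-1 : K) y := by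
  have : y * x * y - y * (y * x) = - (y * (y * x - x * y)) := by noncomm_ring
  rw [Eig, this, hxy]; simp

lemma x_ne (D : SymData K A) (hxy : y * x - x * y = 1) : x ≠ 0 := by
  haveI := D.isDomain
  rintro rfl; simp at hxy
lemma y_ne (D : SymData K A) (hxy : y * x - x * y = 1) : y ≠ 0 := by
  haveI := D.isDomain
  rintro rfl; simp at hxy

lemma hdeg (hxy : y * x - x * y = 1) : 1 ≤ D.deg (y * x) := by
  haveI := D.isDomain
  have := D.comm_deg y x (by rw [hxy]; exact one_ne_zero)
  rw [D.deg_mul (D.y_ne hxy) (D.x_ne hxy)]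
  omega

lemma scal (D : SymData K A) (hxy : y * x - x * y = 1) {e : A} (h1 : x * e = e * x) (h2 : y * e = e * y) :
    ∃ c : K, e = algebraMap K A c := by
  haveI := D.isDomain
  by_cases hd : 1 ≤ D.deg e
  · have := D.comm_cent hd h1.symm h2.symm
    rw [← this, sub_self] at hxy
    exact absurd hxy zero_ne_one
  · have he : Eig (y * x) (0 : K) e := eig0.2 (by rw [mul_assoc, h1, ← mul_assoc, h2, mul_assoc])
    obtain ⟨c, hc⟩ := D.OD (D.hdeg hxy) he (Eig.one _) one_ne_zero (by rw [deg_one]; omega)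
    refine ⟨c, ?_⟩
    rcases hc with hc | hc
    · rw [Algebra.algebraMap_eq_smul_one]; exact sub_eq_zero.1 hc
    · omega

lemma Lx (hxy : y * x - x * y = 1) (n : ℕ) : ∀ (w : A) (l : K), D.M w = n → w ≠ 0 → x * w = w * x →
    Eig (y * x) l w → ∃ (k : ℕ) (c : K), l = k ∧ w = c • x ^ k := by
  haveI := D.isDomain
  induction n using Nat.strong_induction_on with
  | _ n ih =>
  intro w l hn hw hc he
  have e1 : (y * w - w * y) * x = l • w := by
    rw [← he, sub_mul, mul_assoc y w x, ← hc]; noncomm_ring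
  by_cases hl : l = 0
  · rw [hl, zero_smul] at e1
    have h2 := (mul_eq_zero.1 e1).resolve_right (D.x_ne hxy)
    obtain ⟨c, hc⟩ := D.scal hxy hc (sub_eq_zero.1 h2)
    exact ⟨0, c, by simpa using hl, by rw [hc, Algebra.algebraMap_eq_smul_one, pow_zero]⟩
  · have hw' : y * w - w * y ≠ 0 := by
      intro h0
      rw [h0, zero_mul] at e1
      exact smul_ne_zero hl hw e1.symm
    have hM : D.M (y * w - w * y) + D.M x = n := by
      rw [← D.M_mul hw' (D.x_ne hxy), e1, D.M_smul hl hw, hn]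
    have hMx : D.M x ≠ 0 := by
      intro h0
      obtain ⟨c, rfl⟩ := D.M_zero h0
      rw [Algebra.commutes, sub_self] at hxy
      exact zero_ne_one hxy
    have hcomm : x * (y * w - w * y) = (y * w - w * y) * x := by
      have a1 : x * (y * w - w * y) = (x * y) * w - (x * w) * y := by noncomm_ring
      have a2 : (y * w - w * y) * x = y * (x * w) - w * (y * x) := by rw [hc]; noncomm_ring
      have a3 : y * x * w = y * (x * w) := mul_assoc _ _ _
      rw [a1, a2, hc, mul_assoc w x y, xy_eq hxy, sub_mul, mul_sub, a3, hc]; simp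
    have heig : Eig (y * x) (l - 1) (y * w - w * y) := by
      have b1 := (eig_y (K := K) hxy).mul he
      have b2 := he.mul (eig_y (K := K) hxy)
      refine Eig.sub ?_ ?_
      · convert b1 using 1; ring
      · convert b2 using 1; ring
    obtain ⟨k, c, h1, h2⟩ := ih _ (by omega) _ _ rfl hw' hcomm heig
    refine ⟨k + 1, l⁻¹ * c, by push_cast; rw [← h1]; ring, ?_⟩
    rw [mul_smul, pow_succ, ← smul_mul_assoc, ← h2, e1, smul_smul, inv_mul_cancel₀ hl, one_smul]

lemma Lx' (D : SymData K A) (hxy : y * x - x * y = 1) {w : A} {l : K} (hw : w ≠ 0) (hc : x * w = w * x)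
    (he : Eig (y * x) l w) : ∃ (k : ℕ) (c : K), l = k ∧ w = c • x ^ k :=
  D.Lx hxy _ w l rfl hw hc he

lemma Ly' (D : SymData K A) (hxy : y * x - x * y = 1) {w : A} {l : K} (hw : w ≠ 0) (hc : y * w = w * y)
    (he : Eig (y * x) l w) : ∃ (k : ℕ) (c : K), l = -k ∧ w = c • y ^ k := by
  have hxy' : x * (-y) - (-y) * x = 1 := by rw [← hxy]; noncomm_ring
  have he' : Eig (x * (-y)) (-l) w := by
    unfold Eig at *
    have : x * (-y) = 1 - y * x := by rw [mul_neg, xy_eq hxy]; abel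
    rw [this, neg_smul, ← he]; noncomm_ring
  obtain ⟨k, c, h1, h2⟩ := D.Lx' hxy' hw (by rw [neg_mul, hc, mul_neg]) he'
  refine ⟨k, c * (-1) ^ k, by rw [← h1, neg_neg], ?_⟩
  rw [h2, neg_pow, mul_smul]
  congr 1
  rcases Nat.even_or_odd k with hk | hk <;> simp [hk.neg_one_pow]

lemma eig_xy (hxy : y * x - x * y = 1) (k : ℕ) : Eig (y * x) (0 : K) (x ^ k * y ^ k) := by
  have := ((eig_x (K := K) hxy).pow k).mul ((eig_y (K := K) hxy).pow k)
  convert this using 1; ring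

lemma eig_yx (hxy : y * x - x * y = 1) (k : ℕ) : Eig (y * x) (0 : K) (y ^ k * x ^ k) := by
  have := ((eig_y (K := K) hxy).pow k).mul ((eig_x (K := K) hxy).pow k)
  convert this using 1; ring

lemma eig_S (hxy : y * x - x * y = 1) (k : ℕ) {c : A} (hc : Eig (y * x) (0 : K) c) :
    Eig (y * x) (0 : K) (x ^ k * c * y ^ k) := by
  have := (((eig_x (K := K) hxy).pow k).mul hc).mul ((eig_y (K := K) hxy).pow k)
  convert this using 1; ring

lemma cc (D : SymData K A) (hxy : y * x - x * y = 1) {a b : A} (ha : Eig (y * x) (0 : K) a)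
    (hb : Eig (y * x) (0 : K) b) : a * b = b * a :=
  D.comm_cent (D.hdeg hxy) (eig0.1 ha) (eig0.1 hb)

lemma S_mul (D : SymData K A) (hxy : y * x - x * y = 1) (k : ℕ) {c c' : A}
    (hc' : Eig (y * x) (0 : K) c') :
    (x ^ k * c * y ^ k) * (x ^ k * c' * y ^ k) = (x ^ k * (c * c') * y ^ k) * (x ^ k * y ^ k) := by
  have h1 := D.cc hxy (eig_yx hxy k) hc'
  calc _ = x ^ k * c * ((y ^ k * x ^ k) * c') * y ^ k := by noncomm_ring
    _ = _ := by rw [h1]; noncomm_ring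

lemma S_pow (D : SymData K A) (hxy : y * x - x * y = 1) (k : ℕ) {c c' : A}
    (hc : Eig (y * x) (0 : K) c) (hc' : Eig (y * x) (0 : K) c') (j : ℕ) :
    (x ^ k * c' * y ^ k) * (x ^ k * c * y ^ k) ^ j
      = (x ^ k * (c' * c ^ j) * y ^ k) * (x ^ k * y ^ k) ^ j := by
  induction j with
  | zero => simp
  | succ j ih =>
    rw [pow_succ, ← mul_assoc, ih, mul_assoc _ ((x ^ k * y ^ k) ^ j)]
    have h1 : (x ^ k * y ^ k) ^ j * (x ^ k * c * y ^ k) = (x ^ k * c * y ^ k) * (x ^ k * y ^ k) ^ j := by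
      refine D.cc hxy ?_ (eig_S hxy k hc)
      simpa using (eig_xy (K := K) hxy k).pow j
    rw [h1, ← mul_assoc, D.S_mul hxy k hc, mul_assoc c', ← pow_succ c j, mul_assoc _ (x ^ k * y ^ k),
      ← pow_succ' (x ^ k * y ^ k) j]

lemma good_mem (D : SymData K A) (hxy : y * x - x * y = 1) {b : A} (hb : Eig (y * x) (0 : K) b) (k l j : ℕ) :
    (x ^ k * y ^ k) * (x ^ k * b * x ^ l * y ^ (k + l)) ^ j =
      (x ^ (k + l) * y ^ (k + l)) ^ j * (x ^ k * b ^ j * y ^ k) := by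
  have e1 : x ^ k * b * x ^ l * y ^ (k + l) = x ^ k * (b * (x ^ l * y ^ l)) * y ^ k := by
    rw [add_comm k l, pow_add]; noncomm_ring
  have e2 : x ^ (k + l) * y ^ (k + l) = x ^ k * (x ^ l * y ^ l) * y ^ k := by
    rw [pow_add x, add_comm k l, pow_add y]; noncomm_ring
  have hg := eig_xy (K := K) hxy l
  have hbj : Eig (y * x) (0 : K) (b ^ j) := by simpa using hb.pow j
  have h3 := D.S_pow hxy k (c := b * (x ^ l * y ^ l)) (c' := 1) (by simpa using hb.mul hg) (Eig.one _) j
  have h4 := D.S_pow hxy k (c := (x ^ l * y ^ l)) (c' := b ^ j) hg hbj j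
  have hbg : Commute b (x ^ l * y ^ l) := D.cc hxy hb hg
  rw [e1]
  have h5 : (x ^ (k + l) * y ^ (k + l)) ^ j * (x ^ k * b ^ j * y ^ k) =
      (x ^ k * b ^ j * y ^ k) * (x ^ (k + l) * y ^ (k + l)) ^ j := by
    refine D.cc hxy ?_ (eig_S hxy k hbj)
    simpa using (eig_xy (K := K) hxy (k + l)).pow j
  rw [h5, e2, h4, ← hbg.mul_pow]
  simpa using h3

lemma adx_closure (b : A) (m : ℕ) : (adx (K := K) x ^ m) b ∈
    AddSubgroup.closure {v | ∃ k l, k + l = m ∧ v = x ^ k * b * x ^ l} := by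
  induction m with
  | zero => exact AddSubgroup.subset_closure ⟨0, 0, rfl, by simp⟩
  | succ m ih =>
    rw [pow_succ', Module.End.mul_apply]
    generalize (adx (K := K) x ^ m) b = v at ih
    induction ih using AddSubgroup.closure_induction with
    | mem v hv =>
      obtain ⟨k, l, hkl, rfl⟩ := hv
      rw [adx_apply]
      refine AddSubgroup.sub_mem _ (AddSubgroup.subset_closure ⟨k + 1, l, by omega, ?_⟩)
        (AddSubgroup.subset_closure ⟨k, l + 1, by omega, ?_⟩)
      · rw [pow_succ']; noncomm_ring
      · rw [pow_succ]; noncomm_ring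
    | zero => rw [map_zero]; exact AddSubgroup.zero_mem _
    | add a b _ _ h1 h2 => rw [map_add]; exact AddSubgroup.add_mem _ h1 h2
    | neg a _ h1 => rw [map_neg]; exact AddSubgroup.neg_mem _ h1

lemma adx_bound (D : SymData K A) (hxy : y * x - x * y = 1) {b : A} (hb : Eig (y * x) (0 : K) b) (m : ℕ)
    (hne : (adx (K := K) x ^ m) b ≠ 0) : m * D.deg x ≤ D.deg ((adx (K := K) x ^ m) b) := by
  haveI := D.isDomain
  have hx0 := D.x_ne hxy
  have hy0 := D.y_ne hxy
  let Z := Subalgebra.centralizer K ({y * x} : Set A)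
  have hZ : ∀ a : A, a ∈ Z ↔ Eig (y * x) (0 : K) a := by
    intro a
    rw [Subalgebra.mem_centralizer_iff, eig0]
    simp
  letI : CommRing Z :=
    { (inferInstance : Ring Z) with
      mul_comm := fun a b => Subtype.ext (D.cc hxy ((hZ _).1 a.2) ((hZ _).1 b.2)) }
  haveI : IsDomain Z := Function.Injective.isDomain Z.val.toRingHom Subtype.val_injective
  have hgm : x ^ m * y ^ m ∈ Z := (hZ _).2 (eig_xy hxy m)
  have key : ∀ v ∈ AddSubgroup.closure {v | ∃ k l, k + l = m ∧ v = x ^ k * b * x ^ l},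
      ∃ hv : v * y ^ m ∈ Z, Good (⟨x ^ m * y ^ m, hgm⟩ : Z) ⟨v * y ^ m, hv⟩ := by
    intro v hv
    induction hv using AddSubgroup.closure_induction with
    | mem v hv =>
      obtain ⟨k, l, rfl, rfl⟩ := hv
      have hmem : x ^ k * b * x ^ l * y ^ (k + l) ∈ Z := by
        rw [hZ]
        have := ((((eig_x (K := K) hxy).pow k).mul hb).mul ((eig_x (K := K) hxy).pow l)).mul
          ((eig_y (K := K) hxy).pow (k + l))
        convert this using 1; push_cast; ring
      refine ⟨hmem, ⟨x ^ k * y ^ k, (hZ _).2 (eig_xy hxy k)⟩, ?_, fun j =>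
        ⟨⟨x ^ k * b ^ j * y ^ k, (hZ _).2 (eig_S hxy k (by simpa using hb.pow j))⟩, ?_⟩⟩
      · intro h0
        exact mul_ne_zero (pow_ne_zero k hx0) (pow_ne_zero k hy0) (congrArg Subtype.val h0)
      · exact Subtype.ext (D.good_mem hxy hb k l j)
    | zero => exact ⟨by rw [zero_mul]; exact Z.zero_mem, by
        have := Good.zero (R := Z) (g := (⟨x ^ m * y ^ m, hgm⟩ : Z))
        convert this using 1
        exact Subtype.ext (zero_mul _)⟩
    | add a b _ _ h1 h2 =>
      obtain ⟨p1, p2⟩ := h1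
      obtain ⟨q1, q2⟩ := h2
      refine ⟨by rw [add_mul]; exact Z.add_mem p1 q1, ?_⟩
      have := p2.add q2
      convert this using 1
      exact Subtype.ext (add_mul _ _ _)
    | neg a _ h1 =>
      obtain ⟨p1, p2⟩ := h1
      refine ⟨by rw [neg_mul]; exact Z.neg_mem p1, ?_⟩
      have := p2.neg
      convert this using 1
      exact Subtype.ext (neg_mul _ _)
  obtain ⟨hv, q, hq0, hq⟩ := key _ (adx_closure (K := K) b m)
  set v := (adx (K := K) x ^ m) b with hvdef
  obtain ⟨w, hw⟩ := hq (D.deg (q : A) + 1)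
  have hw' : (q : A) * (v * y ^ m) ^ (D.deg (q : A) + 1) =
    (x ^ m * y ^ m) ^ (D.deg (q : A) + 1) * (w : A) := congrArg Subtype.val hw
  have hq0' : (q : A) ≠ 0 := fun h => hq0 (Subtype.ext h)
  have hvy : v * y ^ m ≠ 0 := mul_ne_zero hne (pow_ne_zero _ hy0)
  have hxy0 : x ^ m * y ^ m ≠ 0 := mul_ne_zero (pow_ne_zero _ hx0) (pow_ne_zero _ hy0)
  have hw0 : (w : A) ≠ 0 := by
    intro h0
    rw [h0, mul_zero] at hw'
    exact mul_ne_zero hq0' (pow_ne_zero _ hvy) hw'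
  have hdd := congrArg D.deg hw'
  rw [D.deg_mul hq0' (pow_ne_zero _ hvy), D.deg_mul (pow_ne_zero _ hxy0) hw0, D.deg_pow hvy,
    D.deg_pow hxy0, D.deg_mul hne (pow_ne_zero _ hy0),
    D.deg_mul (pow_ne_zero _ hx0) (pow_ne_zero _ hy0), D.deg_pow hx0, D.deg_pow hy0] at hdd
  by_contra hlt
  push Not at hlt
  nlinarith [Nat.zero_le (D.deg (w : A))]

lemma adx_upper (D : SymData K A) (b : A) (m : ℕ) : (adx (K := K) x ^ m) b ≠ 0 →
    D.deg ((adx (K := K) x ^ m) b) + m ≤ D.deg b + m * D.deg x := by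
  induction m with
  | zero => simp
  | succ m ih =>
    rw [pow_succ', Module.End.mul_apply]
    intro hne
    have h0 : (adx (K := K) x ^ m) b ≠ 0 := by
      intro h0; rw [h0, map_zero] at hne; exact hne rfl
    have := ih h0
    rw [adx_apply] at hne ⊢
    have := D.comm_deg _ _ hne
    rw [add_mul]; omega

lemma adx_nilp (D : SymData K A) (hxy : y * x - x * y = 1) {b : A} (hb : Eig (y * x) (0 : K) b) :
    (adx (K := K) x ^ (D.deg b + 1)) b = 0 := by
  by_contra hne
  have h1 := D.adx_upper b _ hne
  have h2 := D.adx_bound hxy hb _ hne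
  omega

lemma y_h (hxy : y * x - x * y = 1) : y * (y * x) = (y * x + 1) * y := by
  have : y * (y * x) - y * x * y = y * (y * x - x * y) := by noncomm_ring
  rw [hxy, mul_one] at this
  rw [add_mul, one_mul]
  exact sub_eq_iff_eq_add'.1 this

lemma aeval_shift (h : A) (c : K) (p : K[X]) :
    aeval (h + algebraMap K A c) p = aeval h (p.comp (X + C c)) := by
  rw [aeval_comp]; simp

lemma yx_pow (hxy : y * x - x * y = 1) (m : ℕ) : ∃ p : K[X], y ^ m * x ^ m = aeval (y * x) p := by
  induction m with
  | zero => exact ⟨1, by simp⟩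
  | succ m ih =>
    obtain ⟨p, hp⟩ := ih
    refine ⟨p.comp (X + C 1) * X, ?_⟩
    have : y ^ (m + 1) * x ^ (m + 1) = y * (y ^ m * x ^ m) * x := by
      rw [pow_succ', pow_succ]; noncomm_ring
    rw [this, hp, semi (y_h hxy), map_mul, ← aeval_shift, aeval_X, map_one, mul_assoc]

lemma adx_y (hxy : y * x - x * y = 1) (n : ℕ) :
    adx (K := K) x (y ^ (n + 1)) = (-((n : K) + 1)) • y ^ n := by
  rw [adx_apply]
  induction n with
  | zero => rw [zero_add, pow_one, xy_eq hxy]; simp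
  | succ n ih =>
    have : x * y ^ (n + 1 + 1) - y ^ (n + 1 + 1) * x =
      (x * y ^ (n + 1) - y ^ (n + 1) * x) * y - y ^ (n + 1) * (y * x - x * y) := by
      rw [pow_succ y (n + 1)]; noncomm_ring
    rw [this, ih, hxy, mul_one, smul_mul_assoc, ← pow_succ]
    push_cast
    module

lemma adx_pow_y (hxy : y * x - x * y = 1) (m : ℕ) : ∃ κ : K, κ ≠ 0 ∧
    (adx (K := K) x ^ m) (y ^ m) = κ • (1 : A) := by
  induction m with
  | zero => exact ⟨1, one_ne_zero, by simp⟩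
  | succ m ih =>
    obtain ⟨κ, h0, h1⟩ := ih
    refine ⟨-((m : K) + 1) * κ, mul_ne_zero (neg_ne_zero.2 (by exact_mod_cast Nat.succ_ne_zero m)) h0, ?_⟩
    rw [pow_succ, Module.End.mul_apply, adx_y hxy, map_smul, h1, smul_smul]

lemma adx_mul_x (v w : A) (hw : x * w = w * x) (m : ℕ) :
    (adx (K := K) x ^ m) (v * w) = (adx (K := K) x ^ m) v * w := by
  induction m with
  | zero => simp
  | succ m ih =>
    rw [pow_succ', Module.End.mul_apply, ih, Module.End.mul_apply, adx_apply, adx_apply]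
    rw [mul_assoc _ w x, ← hw]; noncomm_ring

lemma adx_eig (hxy : y * x - x * y = 1) {b : A} (hb : Eig (y * x) (0 : K) b) (m : ℕ) :
    Eig (y * x) (m : K) ((adx (K := K) x ^ m) b) := by
  induction m with
  | zero => simpa using hb
  | succ m ih =>
    rw [pow_succ', Module.End.mul_apply, adx_apply]
    have b1 := (eig_x (K := K) hxy).mul ih
    have b2 := ih.mul (eig_x (K := K) hxy)
    refine Eig.sub ?_ ?_
    · convert b1 using 1; push_cast; ring
    · convert b2 using 1; push_cast; ring

theorem cent_eq (D : SymData K A) (hxy : y * x - x * y = 1) (m : ℕ) : ∀ {b : A},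
    Eig (y * x) (0 : K) b → (adx (K := K) x ^ m) b = 0 → ∃ p : K[X], b = aeval (y * x) p := by
  induction m with
  | zero => intro b _ h; exact ⟨0, by simpa using h⟩
  | succ m ih =>
    intro b hb h
    by_cases h0 : (adx (K := K) x ^ m) b = 0
    · exact ih hb h0
    rw [pow_succ', Module.End.mul_apply, adx_apply, sub_eq_zero] at h
    obtain ⟨k, c, hk, hc⟩ := D.Lx' hxy h0 h (adx_eig hxy hb m)
    obtain rfl : m = k := by exact_mod_cast hk
    obtain ⟨κ, hκ0, hκ⟩ := adx_pow_y (K := K) hxy m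
    obtain ⟨p, hp⟩ := yx_pow (K := K) hxy m
    have e1 : (adx (K := K) x ^ m) (y ^ m * x ^ m) = κ • x ^ m := by
      rw [adx_mul_x _ _ (by rw [← pow_succ, ← pow_succ']), hκ, smul_mul_assoc, one_mul]
    obtain ⟨q, hq⟩ := ih (b := b - (c / κ) • (y ^ m * x ^ m)) (hb.sub ((eig_yx hxy m).smul _)) (by
      rw [map_sub, map_smul, e1, hc, smul_smul, div_mul_cancel₀ _ hκ0, sub_self])
    refine ⟨q + C (c / κ) * p, ?_⟩
    rw [map_add, ← hq, map_mul, aeval_C, ← hp, ← Algebra.smul_def]; abel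

theorem cent (D : SymData K A) (hxy : y * x - x * y = 1) {b : A} (hb : Eig (y * x) (0 : K) b) :
    ∃ p : K[X], b = aeval (y * x) p := D.cent_eq hxy _ hb (D.adx_nilp hxy hb)

end W
end SymData


namespace SymData
open Polynomial
set_option linter.unusedSectionVars false
set_option linter.style.haveILetI false
variable {K A : Type*} [Field K] [CharZero K] [Ring A] [Algebra K A] (D : SymData K A)

lemma Gpow {a : A} {m : ℕ} (ha : a ∈ D.G m) (n : ℕ) : a ^ n ∈ D.G (n * m) := by
  induction n with
  | zero => rw [pow_zero]; exact D.Gone _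
  | succ n ih => rw [pow_succ, add_mul, one_mul]; exact D.Gmul _ _ _ _ ih ha

lemma card_le {ι : Type} [Fintype ι] {v : ι → A} (hv : LinearIndependent K v) (n : ℕ)
    (hG : ∀ i, v i ∈ D.G n) : Fintype.card ι ≤ (n + 1) ^ 2 := by
  obtain ⟨t, ht, hle⟩ := D.Gfin n
  haveI : FiniteDimensional K (Submodule.span K (t : Set A)) := FiniteDimensional.span_finset K t
  rw [← finrank_span_eq_card hv]
  refine le_trans (Submodule.finrank_mono (Submodule.span_le.2 ?_))
    ((finrank_span_finset_le_card t).trans ht)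
  rintro _ ⟨i, rfl⟩
  exact hle (hG i)

lemma eigsum {h : A} {ι : Type} {e : ι → K} (he : Function.Injective e) (s : Finset ι) (v : ι → A)
    (hv : ∀ i ∈ s, Eig h (e i) (v i)) (h0 : ∑ i ∈ s, v i = 0) : ∀ i ∈ s, v i = 0 := by
  have h1 := ((Module.End.eigenspaces_iSupIndep (adx (K := K) h)).comp he)
  refine (iSupIndep_iff_finsetSum_eq_zero_imp_eq_zero _).1 h1 s v (fun i hi => ?_) h0
  simp only [Function.comp]
  rw [Module.End.mem_eigenspace_iff, adx_apply]
  exact hv i hi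

lemma eig_aeval (h : A) (p : K[X]) : Eig h (0 : K) (aeval h p) :=
  eig0.2 (aeval_comm (Commute.refl h) p).symm.eq

section W
variable {x y : A} (hxy : y * x - x * y = 1)

theorem rational (D : SymData K A) (hxy : y * x - x * y = 1) {a : A} {l : K} (ha0 : a ≠ 0)
    (ha : Eig (y * x) l a) : ∃ (m : ℕ) (n : ℤ), 1 ≤ m ∧ (m : K) * l = n := by
  haveI := D.isDomain
  by_contra hno
  push Not at hno
  have hinj : Function.Injective (fun jk : ℕ × ℕ => (jk.1 : K) + jk.2 * l) := by
    have aux : ∀ j k j' k' : ℕ, k < k' → (j : K) + k * l = j' + k' * l → False := by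
      intro j k j' k' hk he
      refine hno (k' - k) ((j : ℤ) - j') (by omega) ?_
      push_cast [Nat.cast_sub hk.le]
      linear_combination -he
    rintro ⟨j, k⟩ ⟨j', k'⟩ he
    simp only at he
    rcases lt_trichotomy k k' with hk | hk | hk
    · exact (aux _ _ _ _ hk he).elim
    · subst hk
      have : (j : K) = j' := by simpa using he
      rw [Nat.cast_injective this]
    · exact (aux _ _ _ _ hk he.symm).elim
  obtain ⟨m1, h1⟩ := D.Gex (y * x)
  obtain ⟨m2, h2⟩ := D.Gex x
  obtain ⟨m3, h3⟩ := D.Gex a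
  set M0 := m1 + m2 + m3 with hM0
  set N := (M0 + 1) ^ 2 with hN
  let v : (Fin (N + 1) × Fin (N + 1)) × Fin (N + 1) → A := fun t =>
    (y * x) ^ (t.2 : ℕ) * (x ^ (t.1.1 : ℕ) * a ^ (t.1.2 : ℕ))
  have hv : LinearIndependent K v := by
    rw [Fintype.linearIndependent_iff]
    intro g hg
    rw [Fintype.sum_prod_type] at hg
    let P : Fin (N + 1) × Fin (N + 1) → K[X] := fun t => ∑ i : Fin (N + 1), C (g (t, i)) * X ^ (i : ℕ)
    have hP : ∀ t : Fin (N + 1) × Fin (N + 1), ∑ i, g (t, i) • v (t, i) =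
        aeval (y * x) (P t) * (x ^ (t.1 : ℕ) * a ^ (t.2 : ℕ)) := by
      intro t
      simp only [P, map_sum, Finset.sum_mul, map_mul, aeval_C, map_pow, aeval_X, v]
      refine Finset.sum_congr rfl fun i _ => ?_
      rw [Algebra.smul_def, mul_assoc]
    have hz := eigsum (h := y * x) (e := fun t : Fin (N + 1) × Fin (N + 1) =>
        ((t.1 : ℕ) : K) + (t.2 : ℕ) * l) (by
          rintro ⟨j, k⟩ ⟨j', k'⟩ he
          have := @hinj ((j : ℕ), (k : ℕ)) ((j' : ℕ), (k' : ℕ)) he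
          rw [Prod.mk.injEq] at this ⊢
          exact ⟨Fin.ext this.1, Fin.ext this.2⟩) Finset.univ
        (fun t => ∑ i, g (t, i) • v (t, i)) (fun t _ => by
          rw [hP]
          have := (eig_aeval (K := K) (y * x) (P t)).mul
            (((eig_x (K := K) hxy).pow (t.1 : ℕ)).mul (ha.pow (t.2 : ℕ)))
          convert this using 1; ring) hg
    rintro ⟨t, i⟩
    have hzt := hz t (Finset.mem_univ _)
    simp only [hP] at hzt
    have hpt : P t = 0 := by
      by_contra hne
      exact mul_ne_zero (D.aeval_deg (D.hdeg hxy) hne).1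
        (mul_ne_zero (pow_ne_zero _ (D.x_ne hxy)) (pow_ne_zero _ ha0)) hzt
    have hco := congrArg (fun q => q.coeff (i : ℕ)) hpt
    simp only [P, finsetSum_coeff, coeff_C_mul_X_pow, coeff_zero] at hco
    rw [Finset.sum_eq_single i] at hco
    · simpa using hco
    · intro b _ hb
      exact if_neg fun h => hb (Fin.ext h.symm)
    · intro h; exact absurd (Finset.mem_univ _) h
  have hc := D.card_le hv (N * M0) (by
    rintro ⟨⟨j, k⟩, i⟩
    have hi := Nat.lt_succ_iff.1 i.2
    have hj := Nat.lt_succ_iff.1 j.2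
    have hk := Nat.lt_succ_iff.1 k.2
    have := D.Gmul _ _ _ _ (D.Gpow h1 (i : ℕ)) (D.Gmul _ _ _ _ (D.Gpow h2 (j : ℕ)) (D.Gpow h3 (k : ℕ)))
    refine D.Gmono ?_ this
    have e1 := Nat.mul_le_mul_right m1 hi
    have e2 := Nat.mul_le_mul_right m2 hj
    have e3 := Nat.mul_le_mul_right m3 hk
    rw [hM0, mul_add, mul_add]; omega)
  simp only [Fintype.card_prod, Fintype.card_fin] at hc
  have h5 : (N * M0 + 1) ^ 2 ≤ ((N + 1) * (M0 + 1)) ^ 2 := Nat.pow_le_pow_left (by nlinarith) 2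
  have h6 : (N + 1) * (N + 1) * (N + 1) ≤ (N + 1) * (N + 1) * N := by
    calc _ ≤ _ := hc.trans h5
      _ = _ := by rw [mul_pow, ← hN]; ring
  have := Nat.le_of_mul_le_mul_left h6 (by positivity)
  omega

lemma exists_neg (D : SymData K A) (hxy : y * x - x * y = 1) {a : A} {l : K} (ha0 : a ≠ 0)
    (ha : Eig (y * x) l a) : ∃ u : A, u ≠ 0 ∧ Eig (y * x) (-l) u := by
  haveI := D.isDomain
  obtain ⟨m, n, hm, hmn⟩ := D.rational hxy ha0 ha
  have hp := ha.pow (m - 1)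
  rcases Int.eq_nat_or_neg n with ⟨k, rfl | rfl⟩
  · refine ⟨a ^ (m - 1) * y ^ k, mul_ne_zero (pow_ne_zero _ ha0) (pow_ne_zero _ (D.y_ne hxy)), ?_⟩
    have := hp.mul ((eig_y (K := K) hxy).pow k)
    convert this using 1
    push_cast [Nat.cast_sub hm] at hmn ⊢
    linear_combination -hmn
  · refine ⟨a ^ (m - 1) * x ^ k, mul_ne_zero (pow_ne_zero _ ha0) (pow_ne_zero _ (D.x_ne hxy)), ?_⟩
    have := hp.mul ((eig_x (K := K) hxy).pow k)
    convert this using 1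
    push_cast [Nat.cast_sub hm] at hmn ⊢
    linear_combination -hmn

lemma gen (D : SymData K A) (hxy : y * x - x * y = 1) {u w : A} {l : K} (hu0 : u ≠ 0)
    (hu : Eig (y * x) (-l) u) (hw0 : w ≠ 0) (hw : Eig (y * x) l w)
    (hmin : ∀ a, a ≠ 0 → Eig (y * x) l a → D.deg w ≤ D.deg a) (n : ℕ) :
    ∀ a, D.deg a = n → Eig (y * x) l a → ∃ p : K[X], a = aeval (y * x) p * w := by
  haveI := D.isDomain
  have hd := D.hdeg hxy
  have hh0 : y * x ≠ 0 := mul_ne_zero (D.y_ne hxy) (D.x_ne hxy)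
  have hdg : ∀ a, a ≠ 0 → Eig (y * x) l a → ∃ k, D.deg u + D.deg a = k * D.deg (y * x) := by
    intro a ha0 ha
    obtain ⟨p, hp⟩ := D.cent hxy (b := u * a) (by simpa using hu.mul ha)
    refine ⟨p.natDegree, ?_⟩
    have hp0 : p ≠ 0 := by
      rintro rfl
      rw [map_zero] at hp
      exact mul_ne_zero hu0 ha0 hp
    rw [← D.deg_mul hu0 ha0, hp, (D.aeval_deg hd hp0).2]
  induction n using Nat.strong_induction_on with
  | _ n ih =>
  intro a han ha
  by_cases ha0 : a = 0
  · exact ⟨0, by simp [ha0]⟩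
  obtain ⟨k1, e1⟩ := hdg a ha0 ha
  obtain ⟨k2, e2⟩ := hdg w hw0 hw
  have hle := hmin a ha0 ha
  have hk : k2 ≤ k1 := by
    refine Nat.le_of_mul_le_mul_right (c := D.deg (y * x)) ?_ hd
    omega
  obtain ⟨k, rfl⟩ := Nat.exists_eq_add_of_le hk
  have hb0 : (y * x) ^ k * w ≠ 0 := mul_ne_zero (pow_ne_zero _ hh0) hw0
  have hb : Eig (y * x) l ((y * x) ^ k * w) := by
    simpa using ((Eig.self (K := K) (y * x)).pow k).mul hw
  have hdd : D.deg a = D.deg ((y * x) ^ k * w) := by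
    rw [D.deg_mul (pow_ne_zero _ hh0) hw0, D.deg_pow hh0]
    rw [add_mul] at e1
    omega
  obtain ⟨c, hc⟩ := D.OD hd ha hb hb0 hdd
  have h3 : ∃ p : K[X], a - c • ((y * x) ^ k * w) = aeval (y * x) p * w := by
    rcases hc with hc | hc
    · exact ⟨0, by rw [hc]; simp⟩
    · exact ih _ (han ▸ hc) _ rfl (ha.sub (hb.smul c))
  obtain ⟨p, hp⟩ := h3
  refine ⟨p + C c * X ^ k, ?_⟩
  rw [map_add, add_mul, ← hp, map_mul, aeval_C, map_pow, aeval_X, mul_assoc, ← Algebra.smul_def]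
  abel

lemma scal1 (D : SymData K A) {h a b : A} (hd : 1 ≤ D.deg h) (ha : a ≠ 0) (hb : b ≠ 0) {q : K[X]}
    (he : a * b = aeval h q * (b * a)) : a * b = b * a := by
  haveI := D.isDomain
  have hab := mul_ne_zero ha hb
  have hba := mul_ne_zero hb ha
  have hq0 : q ≠ 0 := by
    rintro rfl
    rw [map_zero, zero_mul] at he
    exact hab he
  obtain ⟨h1, h2⟩ := D.aeval_deg hd hq0
  have h3 := congrArg D.deg he
  rw [D.deg_mul h1 hba, D.deg_mul ha hb, D.deg_mul hb ha, h2] at h3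
  have h4 : q.natDegree = 0 := by
    have : q.natDegree * D.deg h = 0 := by omega
    rcases Nat.mul_eq_zero.1 this with h | h
    · exact h
    · omega
  obtain ⟨c, rfl⟩ : ∃ c, q = C c := ⟨_, eq_C_of_natDegree_eq_zero h4⟩
  have h5 := congrArg D.lc he
  rw [D.lc_mul h1 hba, D.lc_mul ha hb, D.lc_mul hb ha, aeval_C] at h5
  have h6 : D.lc (algebraMap K A c) = C c := by simp [lc, deg, s_alg]
  rw [h6] at h5
  have h7 : C c = (1 : K[X]) := by
    apply mul_right_cancel₀ (mul_ne_zero (D.lc_ne ha) (D.lc_ne hb))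
    linear_combination -h5
  have h8 : c = 1 := C_injective (by rw [h7, C_1])
  rw [he, h8]; simp

lemma x_h (hxy : y * x - x * y = 1) : x * (y * x + 1) = y * x * x := by
  have : y * x * x - x * (y * x) = (y * x - x * y) * x := by noncomm_ring
  rw [hxy, one_mul] at this
  rw [mul_add, mul_one]
  exact (sub_eq_iff_eq_add'.1 this).symm

lemma y_ev (hxy : y * x - x * y = 1) (p : K[X]) :
    y * aeval (y * x) p = aeval (y * x) (p.comp (X + C 1)) * y := by
  rw [semi (y_h hxy), ← aeval_shift, map_one]

lemma x_ev (hxy : y * x - x * y = 1) (p : K[X]) :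
    x * aeval (y * x) (p.comp (X + C 1)) = aeval (y * x) p * x := by
  rw [← aeval_shift, map_one, semi (x_h hxy)]

lemma comp_pm (p : K[X]) : (p.comp (X - C 1)).comp (X + C 1) = p := by
  rw [comp_assoc]; simp

lemma comp_mp (p : K[X]) : (p.comp (X + C 1)).comp (X - C 1) = p := by
  rw [comp_assoc]; simp

theorem main (D : SymData K A) (hxy : y * x - x * y = 1) {a : A} {l : K} (ha0 : a ≠ 0)
    (ha : Eig (y * x) l a) : ∃ k : ℕ, (l = k ∧ ∃ p : K[X], a = aeval (y * x) p * x ^ k) ∨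
      (l = -k ∧ ∃ p : K[X], a = aeval (y * x) p * y ^ k) := by
  classical
  haveI := D.isDomain
  have hd := D.hdeg hxy
  have hx0 := D.x_ne hxy
  have hy0 := D.y_ne hxy
  obtain ⟨u, hu0, hu⟩ := D.exists_neg hxy ha0 ha
  have hex : ∃ n, ∃ w : A, w ≠ 0 ∧ Eig (y * x) l w ∧ D.deg w = n := ⟨_, a, ha0, ha, rfl⟩
  obtain ⟨w, hw0, hw, hwd⟩ := Nat.find_spec hex
  have hmin : ∀ b, b ≠ 0 → Eig (y * x) l b → D.deg w ≤ D.deg b := by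
    intro b hb0 hb
    rw [hwd]
    exact Nat.find_min' hex ⟨b, hb0, hb, rfl⟩
  have hgen := fun b => D.gen hxy hu0 hu hw0 hw hmin _ b rfl
  obtain ⟨f, hf⟩ := hgen a ha
  obtain ⟨p, hp⟩ := hgen (x * w * y) (by
    have := ((eig_x (K := K) hxy).mul hw).mul (eig_y (K := K) hxy)
    convert this using 1; ring)
  obtain ⟨q, hq⟩ := hgen (y * w * x) (by
    have := ((eig_y (K := K) hxy).mul hw).mul (eig_x (K := K) hxy)
    convert this using 1; ring)
  have hwh : w * (y * x) = aeval (y * x) (X - C l) * w := by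
    have : w * (y * x) = y * x * w - l • w := by rw [← hw]; abel
    rw [this, map_sub, aeval_X, aeval_C, sub_mul, ← Algebra.smul_def]
  have hid : p.comp (X + C 1) * q = X * (X - C l) := by
    refine D.aeval_inj hd (mul_right_cancel₀ hw0 ?_)
    have e1 : y * (x * w * y) * x = aeval (y * x) (p.comp (X + C 1) * q) * w := by
      rw [hp, ← mul_assoc y, y_ev hxy, map_mul, mul_assoc _ (aeval (y * x) q) w, ← hq]
      simp only [mul_assoc]
    have e2 : y * (x * w * y) * x = aeval (y * x) (X * (X - C l)) * w := by
      rw [map_mul, mul_assoc _ _ w, ← hwh, aeval_X]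
      simp only [mul_assoc]
    rw [← e1, e2]
  have hdvd : X ∣ p.comp (X + C 1) * q := ⟨_, hid⟩
  rcases prime_X.dvd_or_dvd hdvd with ⟨r, hr⟩ | ⟨r, hr⟩
  · -- w commutes with y
    have e : p = r.comp (X - C 1) * (X - C 1) := by
      rw [← comp_mp p, hr]; simp [mul_comp, mul_comm]
    have h1 : x * (w * y) = x * (aeval (y * x) r * (y * w)) := by
      have hx1 : aeval (y * x) (X - C 1 : K[X]) = x * y := by
        rw [xy_eq hxy]; simp
      rw [← mul_assoc, hp, e, map_mul, hx1]
      have := x_ev (K := K) hxy (r.comp (X - C 1))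
      rw [comp_pm] at this
      rw [← mul_assoc x (aeval (y * x) r), this]
      simp only [mul_assoc]
    have h2 := mul_left_cancel₀ hx0 h1
    obtain ⟨k, c, hk, hc⟩ := D.Ly' hxy hw0 (D.scal1 hd hw0 hy0 h2).symm hw
    refine ⟨k, Or.inr ⟨hk, f * C c, ?_⟩⟩
    rw [hf, hc, map_mul, aeval_C, mul_assoc, ← Algebra.smul_def]
  · have h1 : y * (w * x) = y * (aeval (y * x) (r.comp (X - C 1)) * (x * w)) := by
      rw [← mul_assoc, hq, hr, mul_comm X r, map_mul, aeval_X]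
      have := y_ev (K := K) hxy (r.comp (X - C 1))
      rw [comp_pm] at this
      rw [← mul_assoc y (aeval (y * x) _), this]
      simp only [mul_assoc]
    have h2 := mul_left_cancel₀ hy0 h1
    obtain ⟨k, c, hk, hc⟩ := D.Lx' hxy hw0 (D.scal1 hd hw0 hx0 h2).symm hw
    refine ⟨k, Or.inl ⟨hk, f * C c, ?_⟩⟩
    rw [hf, hc, map_mul, aeval_C, mul_assoc, ← Algebra.smul_def]

lemma mem_ad (h : A) (p : K[X]) : aeval h p ∈ Algebra.adjoin K ({h} : Set A) := by
  rw [Algebra.adjoin_singleton_eq_range_aeval]; exact ⟨p, rfl⟩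

lemma eig_of_mem {h q : A} (hq : q ∈ Algebra.adjoin K ({h} : Set A)) : Eig h (0 : K) q := by
  rw [Algebra.adjoin_singleton_eq_range_aeval] at hq
  obtain ⟨p, rfl⟩ := hq
  exact eig_aeval h p

theorem final (D : SymData K A) (hxy : y * x - x * y = 1) :
    (Algebra.adjoin K {b : A | ∃ lam : K,
        b ≠ 0 ∧ (y * x) * b - b * (y * x) = lam • b}
      = Algebra.adjoin K ({x, y} : Set A))
    ∧ ({lam : K | ∃ b : A, b ≠ 0 ∧ (y * x) * b - b * (y * x) = lam • b}
      = Set.range ((↑) : ℤ → K))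
    ∧ (∀ i : ℤ, 0 ≤ i →
        {b : A | (y * x) * b - b * (y * x) = (i : K) • b}
          = {b : A | ∃ q ∈ Algebra.adjoin K ({y * x} : Set A),
              b = q * x ^ i.toNat})
    ∧ (∀ i : ℤ, i < 0 →
        {b : A | (y * x) * b - b * (y * x) = (i : K) • b}
          = {b : A | ∃ q ∈ Algebra.adjoin K ({y * x} : Set A),
              b = q * y ^ (-i).toNat}) := by
  haveI := D.isDomain
  have hx0 := D.x_ne hxy
  have hy0 := D.y_ne hxy
  have hxm : x ∈ Algebra.adjoin K ({x, y} : Set A) := Algebra.subset_adjoin (by simp)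
  have hym : y ∈ Algebra.adjoin K ({x, y} : Set A) := Algebra.subset_adjoin (by simp)
  have hpm : ∀ p : K[X], aeval (y * x) p ∈ Algebra.adjoin K ({x, y} : Set A) := fun p =>
    Algebra.adjoin_le (by rintro _ rfl; exact mul_mem hym hxm) (mem_ad (y * x) p)
  refine ⟨le_antisymm (Algebra.adjoin_le ?_) (Algebra.adjoin_le ?_), ?_, ?_, ?_⟩
  · rintro b ⟨l, hb0, hb⟩
    obtain ⟨k, ⟨-, p, rfl⟩ | ⟨-, p, rfl⟩⟩ := D.main hxy hb0 hb
    · exact mul_mem (hpm p) (pow_mem hxm k)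
    · exact mul_mem (hpm p) (pow_mem hym k)
  · rintro b (rfl | rfl)
    · exact Algebra.subset_adjoin ⟨1, hx0, eig_x hxy⟩
    · exact Algebra.subset_adjoin ⟨-1, hy0, eig_y hxy⟩
  · ext l
    constructor
    · rintro ⟨b, hb0, hb⟩
      obtain ⟨k, ⟨h1, -⟩ | ⟨h1, -⟩⟩ := D.main hxy hb0 hb
      · exact ⟨k, by simp [h1]⟩
      · exact ⟨-k, by simp [h1]⟩
    · rintro ⟨n, rfl⟩
      rcases Int.eq_nat_or_neg n with ⟨k, rfl | rfl⟩
      · exact ⟨x ^ k, pow_ne_zero _ hx0, by simpa [Eig] using (eig_x (K := K) hxy).pow k⟩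
      · exact ⟨y ^ k, pow_ne_zero _ hy0, by simpa [Eig] using (eig_y (K := K) hxy).pow k⟩
  · intro i hi
    obtain ⟨n, rfl⟩ := Int.eq_ofNat_of_zero_le hi
    ext b
    simp only [Set.mem_ofPred_eq, Int.toNat_natCast]
    constructor
    · intro hb
      by_cases hb0 : b = 0
      · exact ⟨0, zero_mem _, by simp [hb0]⟩
      obtain ⟨k, ⟨h1, p, hp⟩ | ⟨h1, p, hp⟩⟩ := D.main hxy hb0 hb
      · have : n = k := by exact_mod_cast h1
        subst this
        exact ⟨_, mem_ad _ p, hp⟩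
      · have h2 : (n : ℤ) = -k := by exact_mod_cast h1
        obtain ⟨rfl, rfl⟩ : n = 0 ∧ k = 0 := by omega
        exact ⟨_, mem_ad _ p, by simpa using hp⟩
    · rintro ⟨q, hq, rfl⟩
      have := (eig_of_mem hq).mul ((eig_x (K := K) hxy).pow n)
      simpa [Eig] using this
  · intro i hi
    obtain ⟨n, hn⟩ := Int.eq_ofNat_of_zero_le (a := -i) (by omega)
    obtain rfl : i = -(n : ℤ) := by omega
    ext b
    simp only [Set.mem_ofPred_eq, neg_neg, Int.toNat_natCast]
    constructor
    · intro hb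
      by_cases hb0 : b = 0
      · exact ⟨0, zero_mem _, by simp [hb0]⟩
      obtain ⟨k, ⟨h1, p, hp⟩ | ⟨h1, p, hp⟩⟩ := D.main hxy hb0 hb
      · have h2 : -(n : ℤ) = k := by exact_mod_cast h1
        omega
      · have h2 : -(n : ℤ) = -k := by exact_mod_cast h1
        obtain rfl : n = k := by omega
        exact ⟨_, mem_ad _ p, hp⟩
    · rintro ⟨q, hq, rfl⟩
      have := (eig_of_mem hq).mul ((eig_y (K := K) hxy).pow n)
      simpa [Eig] using this

end W
end SymData

/-- **Theorem 1.2.** If `[y,x] = 1` for elements `x, y` of the Weyl algebra `A₁` over a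
field `K` of characteristic zero, then:
* the eigenvector algebra `D(yx)` (the subalgebra generated by all eigenvectors of the
  inner derivation `ad(yx) = [yx, ·]`) equals the subalgebra `K⟨x,y⟩` generated by `x` and
  `y`;
* the set of eigenvalues of `ad(yx)` on `A₁` is exactly `ℤ` (viewed inside `K`);
* for `i ≥ 0` the eigenspace of `ad(yx)` with eigenvalue `i` is `K[yx]·xⁱ`, and for
  `i < 0` it is `K[yx]·y^(−i)`. -/
theorem eigenvector_algebra_of_yx (K : Type*) [Field K] [CharZero K]
    (x y : WeylAlgebra K) (hxy : y * x - x * y = 1) :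
    (Algebra.adjoin K {b : WeylAlgebra K | ∃ lam : K,
        b ≠ 0 ∧ (y * x) * b - b * (y * x) = lam • b}
      = Algebra.adjoin K ({x, y} : Set (WeylAlgebra K)))
    ∧ ({lam : K | ∃ b : WeylAlgebra K, b ≠ 0 ∧ (y * x) * b - b * (y * x) = lam • b}
      = Set.range ((↑) : ℤ → K))
    ∧ (∀ i : ℤ, 0 ≤ i →
        {b : WeylAlgebra K | (y * x) * b - b * (y * x) = (i : K) • b}
          = {b : WeylAlgebra K | ∃ q ∈ Algebra.adjoin K ({y * x} : Set (WeylAlgebra K)),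
              b = q * x ^ i.toNat})
    ∧ (∀ i : ℤ, i < 0 →
        {b : WeylAlgebra K | (y * x) * b - b * (y * x) = (i : K) • b}
          = {b : WeylAlgebra K | ∃ q ∈ Algebra.adjoin K ({y * x} : Set (WeylAlgebra K)),
              b = q * y ^ (-i).toNat}) := by
  exact (WeylSym.data K).final hxy
end
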